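/- Let F be an algebraically closed field of characteristic p = 5 and let M be the Melikian algebra over F. Then H^2(M, M) = F·Sq(1) ⊕ F·Sq(D_1) ⊕ F·Sq(D_2) ⊕ F·Sq(D̃_1) ⊕ F·Sq(D̃_2); in particular dim_F H^2(M, M) = 5. -/

import Mathlib

/-!
STATEMENT 17: for an algebraically closed field `F` of characteristic `5` and the
Melikian algebra `M = A(2) ⊕ W(2) ⊕ W̃(2)`,
`H²(M, M) = F·Sq(1) ⊕ F·Sq(D₁) ⊕ F·Sq(D₂) ⊕ F·Sq(D̃₁) ⊕ F·Sq(D̃₂)`;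
in particular `dim_F H²(M, M) = 5`.

The Melikian algebra is presented as a Lie algebra `M` over `F` together with a linear
equivalence `φ : A(2) × W(2) × W(2) ≃ M` translating the bracket of `M` into the
defining bracket rules of the Melikian algebra (with `div (f₁D₁ + f₂D₂) = D₁f₁ + D₂f₂`):
`[D,E]` is the bracket of `W(2)`; `[D,Ẽ] = ([D,E])~ + 2 div(D)·Ẽ`;
`[D,f] = D(f) − 2 div(D)·f`; `[f₁D̃₁+f₂D̃₂, g₁D̃₁+g₂D̃₂] = f₁g₂ − f₂g₁`; `[f,Ẽ] = f·E`;
`[f,g] = 2(g·D₂f − f·D₂g)·D̃₁ + 2(f·D₁g − g·D₁f)·D̃₂`.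
-/

set_option maxHeartbeats 1000000
set_option synthInstance.maxHeartbeats 400000

noncomputable section

def truncIdeal (F : Type*) [Field F] (p n : ℕ) : Ideal (MvPolynomial (Fin n) F) :=
  Ideal.span (Set.range fun i : Fin n => MvPolynomial.X i ^ p)

abbrev TruncPoly (F : Type*) [Field F] (p n : ℕ) :=
  MvPolynomial (Fin n) F ⧸ truncIdeal F p n

abbrev WittJacobson (F : Type*) [Field F] (p n : ℕ) :=
  Derivation F (TruncPoly F p n) (TruncPoly F p n)

def xcl (F : Type*) [Field F] (p n : ℕ) (i : Fin n) : TruncPoly F p n :=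
  Ideal.Quotient.mk _ (MvPolynomial.X i)

/-- The divergence `div (f₁D₁ + f₂D₂) = D₁(f₁) + D₂(f₂)` of a vector field in `W(2)`
(with `f_i = D(x_i)`). -/
def divW (F : Type*) [Field F] (Dj : Fin 2 → WittJacobson F 5 2)
    (D : WittJacobson F 5 2) : TruncPoly F 5 2 :=
  Dj 0 (D (xcl F 5 2 0)) + Dj 1 (D (xcl F 5 2 1))

def IsLieCocycle2 (F : Type*) {L : Type*} [Field F] [LieRing L] [LieAlgebra F L]
    (c : L → L → L) : Prop :=
  (∀ (t : F) (x x' y : L), c (t • x + x') y = t • c x y + c x' y) ∧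
  (∀ (t : F) (x y y' : L), c x (t • y + y') = t • c x y + c x y') ∧
  (∀ x : L, c x x = 0) ∧
  (∀ x y z : L,
    ⁅x, c y z⁆ + ⁅y, c z x⁆ + ⁅z, c x y⁆ +
      c x ⁅y, z⁆ + c y ⁅z, x⁆ + c z ⁅x, y⁆ = 0)

def IsLieCoboundary2 (F : Type*) {L : Type*} [Field F] [LieRing L] [LieAlgebra F L]
    (c : L → L → L) : Prop :=
  ∃ g : L →ₗ[F] L, ∀ x y : L, c x y = ⁅x, g y⁆ - ⁅y, g x⁆ - g ⁅x, y⁆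

def sqCochain (F : Type*) {L : Type*} [Field F] [LieRing L]
    [LieAlgebra F L] (p : ℕ) (D : L → L) : L → L → L :=
  fun x y => ∑ i ∈ Finset.Icc 1 (p - 1),
    (((Nat.factorial i * Nat.factorial (p - i) : ℕ) : F))⁻¹ • ⁅D^[i] x, D^[p - i] y⁆

namespace Melikian

/-- Evaluates `n` before passing it to `f`. -/
def force {α : Type} (n : ℕ) (f : ℕ → α) : α :=
  match n with
  | 0 => f 0
  | k + 1 => f (Nat.succ k)

/-- The term `c • e (25 t + 5 a + b)` (nothing if an exponent is too big or `5 ∣ c`). -/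
def term (t a b c : ℕ) : List (ℕ × ℕ) :=
  force (c % 5) fun c =>
    bif Nat.ble 5 a || Nat.ble 5 b || Nat.beq c 0 then [] else
      force (25 * t + 5 * a + b) fun n => [(n, c)]

def brk (a b c d : ℕ) : ℕ → ℕ → List (ℕ × ℕ)
  | 0, 0 => term 3 (a + c) (b + d - 1) (2 * b + 8 * d) ++ term 4 (a + c - 1) (b + d) (2 * c + 8 * a)
  | 0, 1 => term 0 (a + c - 1) (b + d) (4 * a + 2 * c)
  | 0, 2 => term 0 (a + c) (b + d - 1) (4 * b + 2 * d)
  | 0, 3 => term 1 (a + c) (b + d) 1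
  | 0, 4 => term 2 (a + c) (b + d) 1
  | 1, 0 => term 0 (a + c - 1) (b + d) (c + 3 * a)
  | 1, 1 => term 1 (a + c - 1) (b + d) (c + 4 * a)
  | 1, 2 => term 2 (a + c - 1) (b + d) c ++ term 1 (a + c) (b + d - 1) (4 * b)
  | 1, 3 => term 3 (a + c - 1) (b + d) (c + a)
  | 1, 4 => term 4 (a + c - 1) (b + d) (c + 2 * a) ++ term 3 (a + c) (b + d - 1) (4 * b)
  | 2, 0 => term 0 (a + c) (b + d - 1) (d + 3 * b)
  | 2, 1 => term 1 (a + c) (b + d - 1) d ++ term 2 (a + c - 1) (b + d) (4 * a)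
  | 2, 2 => term 2 (a + c) (b + d - 1) (d + 4 * b)
  | 2, 3 => term 3 (a + c) (b + d - 1) (d + 2 * b) ++ term 4 (a + c - 1) (b + d) (4 * a)
  | 2, 4 => term 4 (a + c) (b + d - 1) (d + b)
  | 3, 0 => term 1 (a + c) (b + d) 4
  | 3, 1 => term 3 (a + c - 1) (b + d) (4 * (a + c))
  | 3, 2 => term 3 (a + c) (b + d - 1) (4 * (b + 2 * d)) ++ term 4 (a + c - 1) (b + d) c
  | 3, 4 => term 0 (a + c) (b + d) 1
  | 4, 0 => term 2 (a + c) (b + d) 4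
  | 4, 1 => term 4 (a + c - 1) (b + d) (4 * (a + 2 * c)) ++ term 3 (a + c) (b + d - 1) d
  | 4, 2 => term 4 (a + c) (b + d - 1) (4 * (b + d))
  | 4, 3 => term 0 (a + c) (b + d) 4
  | _, _ => []

/-- Structure constants: `⁅e i, e j⁆ = ∑ c • e k` over the pairs `(k, c)` of `br i j`. -/
def br (i j : ℕ) : List (ℕ × ℕ) :=
  force (i / 5 % 5) fun a => force (i % 5) fun b => force (j / 5 % 5) fun c => force (j % 5) fun d =>
    brk a b c d (i / 25) (j / 25)

def sh1 : ℕ → ℕ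
  | 0 => 3
  | 1 => 4
  | 2 => 0
  | 3 => 1
  | _ => 2

def sh2 : ℕ → ℕ
  | 0 => 3
  | 1 => 0
  | 2 => 4
  | 3 => 2
  | _ => 1

/-- Torus weights of the basis vectors. -/
def w1 (n : ℕ) : ℕ := (n / 5 % 5 + sh1 (n / 25)) % 5
def w2 (n : ℕ) : ℕ := (n % 5 + sh2 (n / 25)) % 5

/-- The basis index of type `t` and weight `(u, v)`. -/
def ix (u v t : ℕ) : ℕ := 25 * t + 5 * ((u + 4 * sh1 t) % 5) + (v + 4 * sh2 t) % 5

def ckey (i j t : ℕ) : ℕ := (i * 125 + j) * 5 + t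

def cterm (i j t c : ℕ) : List (ℕ × ℕ) :=
  bif Nat.blt i j then [(ckey i j t, c)] else bif Nat.blt j i then [(ckey j i t, 4 * c)] else []

/-- Coefficient of `e l` in a formal combination, as a list of keys. -/
def pick (l : ℕ) (f : ℕ → List (ℕ × ℕ)) : List (ℕ × ℕ) → List (ℕ × ℕ)
  | [] => []
  | p :: L => bif Nat.beq p.1 l then f p.2 ++ pick l f L else pick l f L

def typesum (f : ℕ → List (ℕ × ℕ)) : List (ℕ × ℕ) := f 0 ++ (f 1 ++ (f 2 ++ (f 3 ++ f 4)))

def push (x t : ℕ) : List (ℕ × ℕ) → List (ℕ × ℕ)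
  | [] => []
  | p :: L => cterm x p.1 t p.2 ++ push x t L

/-- Coordinates of `⁅e x, c (e y) (e z)⁆ + c (e x) ⁅e y, e z⁆`, where `c (e y) (e z)` has
weight `(u, v)`. -/
def half (x y z t l u v : ℕ) : List (ℕ × ℕ) :=
  force u fun u => force v fun v =>
  typesum (fun s => pick l (cterm y z s) (force (ix u v s) (br x))) ++
    push x t (br y z)

def jac (x y z t : ℕ) : List (ℕ × ℕ) :=
  force (w1 x) fun x1 => force (w1 y) fun y1 => force (w1 z) fun z1 =>
  force (w2 x) fun x2 => force (w2 y) fun y2 => force (w2 z) fun z2 =>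
  force (ix (x1 + y1 + z1) (x2 + y2 + z2) t) fun l =>
    half x y z t l (y1 + z1) (y2 + z2) ++
      (half y z x t l (z1 + x1) (z2 + x2) ++ half z x y t l (x1 + y1) (x2 + y2))

def jacN (n : ℕ) : List (ℕ × ℕ) :=
  force (n / 78125 % 125) fun x => force (n / 625 % 125) fun y => force (n / 5 % 125) fun z =>
    force (n % 5) fun t => jac x y z t

/-- Membership of `k` in the bit mask `m`. -/
def bit (m k : ℕ) : Bool := Nat.beq ((m >>> k) % 2) 1

/-- The sum of the coefficients of the key `u`, started at `s`, if all other keys are in the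
mask `m`; otherwise `0`. -/
def rest (m u s : ℕ) : List (ℕ × ℕ) → ℕ
  | [] => s
  | p :: L => bif bit m p.1 then rest m u s L else bif Nat.beq p.1 u then rest m u (s + p.2) L else 0

/-- Adds to the mask `m` of vanishing variables the one that the equation `∑ c • v k = 0` over
the pairs `(k, c)` of a list forces to vanish, if there is such a variable. -/
def learn (m : ℕ) : List (ℕ × ℕ) → ℕ
  | [] => m
  | p :: L => bif bit m p.1 then learn m L else
      bif Nat.beq (rest m p.1 p.2 L % 5) 0 then m else m ||| (1 <<< p.1)

/-- Unit propagation through the equations `D n`. -/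
def learnAll (D : ℕ → List (ℕ × ℕ)) : List ℕ → ℕ → ℕ
  | [], m => m
  | n :: L, m => force (learn m (D n)) (learnAll D L)

/-- Whether every equation `D n` determines a new variable. -/
def triangular (D : ℕ → List (ℕ × ℕ)) : List ℕ → ℕ → Bool
  | [], _ => true
  | n :: L, m => force (learn m (D n)) fun m' => bif Nat.beq m' m then false else triangular D L m'

def setAll : List ℕ → ℕ → ℕ
  | [], m => m
  | k :: L, m => setAll L (m ||| (1 <<< k))

/-- Coordinate `l` of `⁅e x, h (e y)⁆`, times `s`; the coordinate `m` of `h (e y)` has key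
`y * 125 + m`. -/
def dhHalf (s x y l : ℕ) : List (ℕ × ℕ) :=
  typesum fun t => force (ix (w1 l + 4 * w1 x) (w2 l + 4 * w2 x) t) fun m =>
    pick l (fun c => [(y * 125 + m, s * c)]) (br x m)

def dhTail (l : ℕ) : List (ℕ × ℕ) → List (ℕ × ℕ)
  | [] => []
  | p :: L => (p.1 * 125 + l, 4 * p.2) :: dhTail l L

/-- Coordinate `l` of `⁅e x, h (e y)⁆ - ⁅e y, h (e x)⁆ - h ⁅e x, e y⁆`. -/
def dhTerms (x y l : ℕ) : List (ℕ × ℕ) :=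
  dhHalf 1 x y l ++ (dhHalf 4 y x l ++ dhTail l (br x y))

def dhN (n : ℕ) : List (ℕ × ℕ) :=
  force (n / 625 % 125) fun x => force (n / 5 % 125) fun y =>
    force (ix (w1 x + w1 y) (w2 x + w2 y) (n % 5)) fun l => dhTerms x y l

def brN (n : ℕ) : List (ℕ × ℕ) := br (n / 125) (n % 125)

/-- Unit propagation through the brackets of pairs of known basis vectors. -/
def generate : List ℕ → ℕ → ℕ
  | [], m => m
  | n :: L, m => bif bit m (n / 125) && bit m (n % 125) then
      force (learn m (brN n)) (generate L) else generate L m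

/-- Whether `f` holds at all numbers below a bound. -/
def allBelow (f : ℕ → Bool) : ℕ → Bool
  | 0 => true
  | n + 1 => f n && allBelow f n

/-- Whether the mask contains all coordinates of `c (e g) (e b)`. -/
def covers (m g : ℕ) : Bool :=
  allBelow (fun b => allBelow (fun t => match cterm g b t 1 with
    | [] => true
    | p :: _ => bit m p.1) 5) 125

/-- Whether the bracket `⁅e i, e j⁆` respects the weights. -/
def graded (i j : ℕ) : List (ℕ × ℕ) → Bool
  | [] => true
  | p :: L => (Nat.blt p.1 125 && (Nat.beq (w1 p.1) ((w1 i + w1 j) % 5) &&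
      Nat.beq (w2 p.1) ((w2 i + w2 j) % 5))) && graded i j L

set_option maxRecDepth 100000 in
/-- Coordinates of a cochain that can be made zero by subtracting a coboundary. -/
def gaugeKeys : List ℕ :=
  [125, 752, 1376, 1377, 1378, 2001, 2002, 2004, 2626, 2627, 2628, 2629, 3877, 4502, 4503, 5127,
   5129, 5752, 5753, 5754, 7628, 8254, 8878, 8879, 11379, 12004, 15757, 15759, 15762, 15763, 15764,
   15765, 15767, 15768, 15769, 15770, 15772, 15773, 15774, 15784, 15788, 15789, 15790, 15793, 15794,
   15795, 15798, 15799, 15803, 15809, 15814, 15815, 15819, 15820, 15824, 15840, 15845, 15876, 15880,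
   15881, 15883, 15884, 15886, 15889, 15891, 15893, 15894, 15895, 15896, 15898, 15899, 15901, 15905,
   15906, 15911, 15914, 15916, 15919, 15920, 15921, 15924, 15926, 15930, 15931, 15936, 15941, 15945,
   15946, 15951, 15956, 15961, 15966, 15971, 16000, 127, 3252, 15779, 15804, 15808, 15879, 16001,
   128, 129, 753, 754, 1379, 2003, 3253, 3254, 3878, 3879, 4504, 5128, 6378, 6379, 7003, 7004, 7629,
   8253, 9504, 10129, 10754, 15755, 15760, 15775, 15780, 15785, 15800, 15805, 15810, 15825, 15830,
   15835, 15875, 15885, 15890, 15900, 15910, 15915, 15925, 15935, 15940, 16002, 16004, 16005, 16006,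
   16007, 16009, 16010, 16011, 16012, 16014, 16015, 16016, 16017, 16019, 16020, 16021, 16022, 16024,
   16025, 16026, 16027, 16030, 16031, 16032, 16035, 16036, 16037, 16040, 16041, 16042, 16045, 16046,
   16047, 16051, 16052, 16056, 16057, 16061, 16062, 16066, 16067, 16071, 16072, 16077, 16082, 16087,
   16092, 16097, 16125, 126, 751, 15758, 15878, 15888, 15904, 15909, 16126, 16127, 16128, 16130,
   16131, 16132, 16133, 16135, 16136, 16137, 16138, 16140, 16141, 16142, 16143, 16145, 16146, 16147,
   16148, 16151, 16152, 16153, 16156, 16157, 16158, 16161, 16162, 16163, 16166, 16167, 16168, 16171,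
   16172, 16173, 16177, 16178, 16182, 16183, 16187, 16188, 16192, 16193, 16197, 16198, 16203, 16208,
   16213, 16218, 16223, 3376, 6376, 9501, 12626, 4001, 7001, 10126, 13251, 6502, 9502, 12627, 9628,
   12628, 10253, 13253, 10878, 13878, 11503, 14503, 12754, 13379, 14004, 19002, 15802, 15827, 15852,
   19627, 15807, 15832, 15857, 20252, 15812, 15837, 15862, 20877, 15817, 15842, 15867, 22128, 15828,
   15853, 22753, 15833, 15858, 25254, 15854, 28375, 29000, 29625, 31528, 15928, 15953, 15978, 31533,
   15933, 15958, 15983, 31538, 15938, 15963, 15988, 31554, 15954, 15979, 31559, 15959, 15984, 31575,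
   15975, 31580, 15980, 31585, 15985, 31590, 15990, 31601, 31654, 16054, 16079, 16104, 31659, 16059,
   16084, 16109, 31664, 16064, 16089, 16114, 31669, 16069, 16094, 16119, 31675, 16075, 16100, 31701,
   16101, 31706, 16106, 31711, 16111, 31727, 31732, 31775, 16175, 16200, 16225, 31780, 16180, 16205,
   16230, 31801, 16201, 16226, 31806, 16206, 16231, 31811, 16211, 16236, 31816, 16216, 16241, 31827,
   16227, 31832, 16232, 31837, 16237, 31853, 6002, 15822, 15847, 15872, 422, 16074, 16099, 16124,
   19128, 3501, 29, 3250, 6375, 9500, 12625, 15801, 15826, 15851, 16028, 16053, 16078, 16103, 16154,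
   16179, 16204, 16229, 8, 3875, 7000, 10125, 13250, 875, 15902, 15927, 15952, 15977, 1500, 4500,
   7625, 10750, 13875, 2125, 5125, 8250, 11375, 14500, 2750, 5750, 8875, 12000, 15125, 16501, 15781,
   15806, 15831, 15856, 17126, 15786, 15811, 15836, 15861, 17751, 15791, 15816, 15841, 15866, 18376,
   15796, 15821, 15846, 15871, 31507, 15907, 15932, 15957, 15982, 31512, 15912, 15937, 15962, 15987,
   31517, 15917, 15942, 15967, 15992, 31522, 15922, 15947, 15972, 15997, 31633, 16033, 16058, 16083,
   16108, 31638, 16038, 16063, 16088, 16113, 31643, 16043, 16068, 16093, 16118, 31648, 16048, 16073,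
   16098, 16123, 31759, 16159, 16184, 16209, 16234, 31764, 16164, 16189, 16214, 16239, 31769, 16169,
   16194, 16219, 16244, 31774, 16174, 16199, 16224, 16249, 47306, 16080, 16105, 31685, 16085, 16110,
   31690, 16090, 16115, 31695, 16095, 16120, 438, 15838, 15863, 24003, 15843, 15868, 24628, 15848,
   15873, 186, 7626, 10751, 13876, 5251, 8251, 11376, 14501, 5876, 8876, 12001, 15126, 291, 15943,
   15968, 15993, 31548, 15948, 15973, 15998, 459, 15859, 26504, 15864, 27129, 15869, 27754, 15874,
   207, 10127, 13252, 7752, 10752, 13877, 8377, 11377, 14502, 9002, 12002, 15127, 60, 16185, 16210,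
   16235, 31790, 16190, 16215, 16240, 31795, 16195, 16220, 16245, 312, 15964, 15989, 31569, 15969,
   15994, 31574, 15974, 15999, 13626, 31611, 31616, 31621, 606, 31863, 31868, 31873, 3821, 16121,
   31721, 16116, 30376, 30875, 248, 15128, 96, 16221, 16246, 490, 31742, 31747, 14750, 15254, 117,
   16242, 31847, 16247, 374, 15995]

set_option maxRecDepth 100000 in
/-- Cocycle identities in the order of their use. -/
def cocycleSteps : List ℕ :=
  [750, 751, 752, 1382, 1503, 3253, 3254, 3878, 6379, 9626, 10750, 15126, 15252, 15775, 15836, 15857,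
   15876, 15879, 15880, 15888, 15894, 15898, 15941, 15962, 16000, 16001, 16002, 16003, 16004, 16007,
   16008, 16058, 16088, 16109, 16125, 16126, 16128, 16129, 16131, 17202, 17801, 18502, 22126, 24001,
   24752, 25252, 26502, 28378, 31526, 31546, 31567, 31652, 31678, 31693, 31778, 44251, 45501, 47366,
   79500, 79501, 79502, 80125, 80126, 80127, 80750, 80751, 80752, 80754, 81378, 81504, 82000, 82001,
   82002, 82003, 93881, 93882, 93883, 93886, 93887, 93888, 93891, 93892, 93893, 93896, 93897, 93898,
   93902, 93903, 93904, 93998, 94002, 94003, 94004, 94007, 94008, 94009, 94011, 94012, 94013, 94014,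
   94017, 94018, 94022, 94023, 94024, 94025, 94119, 94125, 94127, 94128, 94129, 94130, 94132, 94133,
   94134, 94135, 94138, 94139, 94140, 94143, 94144, 94148, 94149, 94171, 94250, 94251, 94253, 94254,
   94255, 94256, 94259, 94260, 94261, 94264, 94265, 94266, 94269, 94270, 94271, 94274, 94534, 94896,
   96651, 100198, 100269, 100496, 100622, 158251, 158252, 158877, 160753, 165276, 171382, 172018,
   172023, 172034, 172126, 172129, 172136, 172150, 172181, 172233, 172250, 172252, 172253, 172254,
   172375, 172376, 172378, 172379, 172391, 172470, 172995, 178433, 181533, 188615, 191582, 191607,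
   191668, 191693, 191718, 191743, 194709, 239502, 250238, 250261, 250375, 250377, 250378, 250379,
   250500, 250501, 250503, 250504, 250506, 250511, 250879, 298681, 316451, 328400, 328500, 328502,
   328503, 328504, 328510, 328625, 328626, 328628, 328629, 375581, 379317, 394571, 394625, 397126,
   400252, 403378, 407125, 409626, 409751, 410476, 414227, 415888, 416120, 418378, 419004, 422131,
   422152, 422177, 422204, 422249, 422252, 422278, 422325, 422356, 422363, 422378, 422404, 422425,
   422493, 423489, 425477, 450498, 450609, 477651, 477766, 477792, 478108, 484625, 484771, 487218,
   487233, 490203, 490218, 490354, 490369, 494296, 494351, 502272, 502357, 518725, 562750, 579215,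
   596101, 596212, 599207, 630875, 640875, 719000, 728378, 790151, 797126, 797251, 800585, 802129,
   803378, 812178, 813025, 813075, 872192, 872646, 873648, 875251, 875378, 878060, 878715, 878918,
   879325, 962728, 1031501, 1109626, 1109752, 1125575, 1144256, 1182126, 1187752, 1197128, 1200253,
   1203404, 1203625, 1265772, 1266145, 1343892, 1344002, 1422127, 1500132, 1500252, 1578378, 1584629,
   1594125, 1594152, 1594251, 1626151, 1628666, 1654627, 1656503, 1656645, 1656771, 1734649, 1750501,
   1906625, 1906652, 1969524, 1969625, 1969645, 1969750, 1969751, 1969754, 1969875, 1969876, 1969877,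
   1969887, 1969897, 1970144, 1970276, 1970375, 1970376, 1970379, 1970500, 1970501, 1970502, 1970622,
   1970901, 1971000, 1971001, 1971004, 1971011, 1971125, 1971126, 1971127, 1971147, 1971400, 1971526,
   1971625, 1971626, 1971750, 1971751, 1971752, 1972058, 1972131, 1972136, 1972140, 1972250, 1972251,
   1972252, 1972266, 1972376, 1972377, 1972378, 1973376, 1973943, 1974001, 1974626, 1975252, 1975378,
   1975877, 1976502, 1977127, 1978378, 1979003, 1982754, 1984004, 1984636, 1984639, 1984641, 1984646,
   1984652, 1984657, 1984662, 1984667, 1984672, 1984678, 1984683, 1984688, 1984704, 1984709, 1984725,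
   1984730, 1984735, 1984740, 1984750, 1984751, 1984752, 1984762, 1984798, 1984804, 1984809, 1984814,
   1984835, 1984845, 1984851, 1984856, 1984871, 1984875, 1984876, 1984877, 1984878, 1984888, 1984893,
   1984898, 1984909, 1984925, 1984930, 1984940, 1984945, 1984951, 1984956, 1984961, 1984977, 1984982,
   1984987, 1984997, 1985277, 1985282, 1985375, 1985376, 1985377, 1985500, 1985501, 1985502, 1985503,
   1985902, 1985911, 1986000, 1986001, 1986002, 1986006, 1986011, 1986125, 1986126, 1986127, 1986128,
   1986138, 1986147, 1986540, 1986541, 1986625, 1986626, 1986627, 1986750, 1986751, 1986752, 1986753,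
   1986763, 1987152, 1987250, 1987251, 1987252, 1987375, 1987376, 1987377, 1987378, 1987898, 1988019,
   1988024, 1989060, 1991126, 2000380, 2000381, 2000382, 2000383, 2000385, 2000386, 2000387, 2000388,
   2000390, 2000391, 2000392, 2000393, 2000395, 2000396, 2000397, 2000398, 2000401, 2000402, 2000403,
   2000404, 2000452, 2000456, 2000457, 2000462, 2000467, 2000472, 2000488, 2000501, 2000502, 2000503,
   2000504, 2000506, 2000507, 2000508, 2000509, 2000511, 2000512, 2000513, 2000514, 2000516, 2000517,
   2000518, 2000519, 2000521, 2000522, 2000523, 2000524, 2001030, 2001126, 2001127, 2001128, 2001129,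
   2001751, 2001752, 2001753, 2001754, 2001764, 2001774, 2002353, 2002376, 2002377, 2002378, 2002379,
   2002978, 2003001, 2003002, 2003003, 2003004, 2003014, 2006704, 2007964, 2009851, 2016130, 2016132,
   2016133, 2016134, 2016135, 2016137, 2016138, 2016139, 2016140, 2016142, 2016143, 2016144, 2016145,
   2016147, 2016148, 2016149, 2016150, 2016151, 2016152, 2016153, 2016154, 2016198, 2016219, 2016765,
   2016780, 2016783, 2017410, 2017413, 2018724, 2026233, 2026863, 2062756, 2062777, 2063029, 2375383,
   2391056, 2766125, 2766177, 2782351, 2782422, 2783582, 2784226, 2784282, 2794282, 2798033, 2993378,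
   3150875, 3153375, 3156525, 3156575, 3156625, 3156751, 3469100, 3547251, 3547377, 3623375, 3859700,
   3859751, 3938403, 3938450, 3941051, 3941125, 3941177, 3944125, 3944277, 3947251, 3947377, 3947427,
   3948465, 3950377, 3952246, 3953525, 3953551, 3953561, 3953651, 3953677, 3956655, 3956751, 3959877,
   3959903, 3959977, 3963003, 3963588, 3969256, 3969266, 3969277, 3969291, 3969301, 3969316, 3969326,
   3969341, 3969350, 3969351, 3969366, 3972407, 3972429, 3975559, 4113646, 4113726, 4116826, 4119926,
   4128052, 4128102, 5516057, 5908657, 5909897, 5911757, 5912308, 5912377, 5922481, 5987376, 6000601,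
   6309876, 6391201, 7484881, 753, 762, 799, 904, 2128, 3258, 3483, 3876, 3877, 4004, 6500, 7003,
   8375, 9504, 10251, 13875, 15923, 15946, 15987, 16127, 24626, 27127, 29003, 31698, 31714, 31783,
   31804, 47378, 79628, 81376, 81377, 82274, 82626, 83252, 83876, 83877, 84503, 84504, 85127, 85128,
   87751, 93907, 93908, 93912, 93913, 93914, 93917, 93918, 93922, 93928, 93929, 93973, 94028, 94029,
   94033, 94034, 94036, 94038, 94039, 94043, 94048, 94049, 94050, 94150, 94154, 94155, 94159, 94160,
   94164, 94165, 94169, 94174, 94196, 94275, 94276, 94280, 94281, 94285, 94286, 94290, 94291, 94296,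
   94518, 94791, 96608, 96618, 100251, 103377, 106503, 109651, 109777, 109803, 109903, 112976,
   113647, 125497, 131249, 143729, 159629, 160125, 160126, 160127, 161376, 162002, 163878, 172043,
   172059, 172161, 172175, 172401, 172416, 172648, 178406, 178456, 178481, 178483, 178648, 178673,
   181531, 181581, 181773, 184898, 191849, 194899, 198024, 201149, 238250, 238251, 238252, 242627,
   250286, 298729, 316375, 316376, 316377, 328425, 328651, 329256, 394629, 397004, 403377, 406501,
   406504, 406513, 406519, 406625, 406629, 406632, 406750, 406751, 407750, 410218, 410369, 410481,
   412751, 415876, 419629, 422176, 422202, 422209, 422257, 422277, 422303, 422330, 422383, 422403,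
   422429, 422430, 424109, 427352, 437998, 475251, 478377, 481723, 484506, 484507, 484508, 484511,
   484512, 484513, 484514, 484516, 484517, 484518, 484521, 484522, 484523, 484527, 484528, 484529,
   484627, 484628, 484629, 484632, 484633, 484634, 484637, 484638, 484639, 484642, 484643, 484647,
   484648, 484649, 484719, 484750, 484754, 484755, 484758, 484759, 484760, 484763, 484764, 484765,
   484768, 484769, 484773, 484774, 484875, 484876, 484880, 484881, 484884, 484885, 484886, 484889,
   484890, 484891, 484894, 484895, 484896, 484899, 487251, 487751, 494146, 495878, 495978, 497129,
   500256, 500277, 500329, 500377, 500403, 500450, 500496, 500503, 500529, 500550, 500602, 502351,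
   505477, 512976, 518674, 528648, 528733, 562751, 562754, 562875, 562879, 563000, 563001, 578701,
   582184, 641000, 641004, 641125, 641126, 641131, 641136, 656725, 719125, 719129, 719135, 719250,
   719251, 797252, 797378, 800889, 806503, 812809, 812878, 813004, 813030, 875545, 881503, 891150,
   891200, 1047455, 1109625, 1182751, 1187751, 1187876, 1190377, 1203409, 1203504, 1203552, 1266045,
   1266171, 1275253, 1278378, 1281750, 1500251, 1500377, 1577127, 1578377, 1578625, 1587753, 1594261,
   1594275, 1594300, 1662754, 1672250, 1672277, 1734627, 1812752, 1828532, 1828626, 1890877, 1969549,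
   1969782, 1970789, 1970926, 1971409, 1971425, 1972254, 1972678, 1972750, 1972875, 1972876, 1973001,
   1973002, 1973012, 1973022, 1973500, 1973501, 1973625, 1973626, 1973627, 1974125, 1974126, 1974136,
   1974250, 1974251, 1974252, 1974272, 1974750, 1974751, 1974875, 1974876, 1974877, 1975265, 1975375,
   1975376, 1975377, 1975391, 1975500, 1975501, 1975502, 1975503, 1976004, 1976501, 1977751, 1978503,
   1978625, 1979002, 1979627, 1981004, 1981625, 1981751, 1984671, 1984677, 1984682, 1984687, 1984703,
   1984708, 1984729, 1984776, 1984787, 1984823, 1984829, 1984860, 1984870, 1984934, 1984950, 1984955,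
   1984965, 1984970, 1984976, 1985379, 1985384, 1985904, 1985936, 1986031, 1986036, 1986152, 1986172,
   1986566, 1986652, 1986746, 1986788, 1987151, 1987177, 1987875, 1987876, 1987877, 1988002, 1988003,
   1988500, 1988501, 1988502, 1988626, 1988627, 1988628, 1989125, 1989126, 1989127, 1989251, 1989252,
   1989253, 1989263, 1989750, 1989751, 1989752, 1989876, 1989877, 1989878, 1989888, 1990375, 1990376,
   1990377, 1990501, 1990502, 1990503, 1991023, 1991125, 1991144, 1991149, 1994125, 1997251, 1997377,
   2000406, 2000407, 2000408, 2000410, 2000411, 2000412, 2000413, 2000415, 2000416, 2000417, 2000418,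
   2000421, 2000422, 2000423, 2000425, 2000426, 2000428, 2000429, 2000445, 2000451, 2000461, 2000481,
   2000527, 2000528, 2000529, 2000532, 2000533, 2000534, 2000537, 2000538, 2000539, 2000542, 2000543,
   2000544, 2000547, 2000548, 2000549, 2000551, 2000577, 2001789, 2003627, 2003628, 2003629, 2003649,
   2004252, 2004253, 2004254, 2004877, 2004878, 2004879, 2004899, 2005453, 2005502, 2005503, 2005504,
   2006078, 2006127, 2006128, 2006129, 2006751, 2009877, 2013003, 2016155, 2016156, 2016158, 2016159,
   2016160, 2016163, 2016164, 2016165, 2016168, 2016169, 2016170, 2016174, 2016175, 2016177, 2016178,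
   2016790, 2016805, 2016808, 2017435, 2017438, 2021824, 2062877, 2078639, 2140881, 2140902, 2156728,
   2219079, 2285624, 2297178, 2375388, 2375435, 2376828, 2765975, 2766004, 2766182, 2767971, 2844250,
   2859781, 3078551, 3156530, 3156580, 3156671, 3156756, 3156826, 3234876, 3472200, 3625376, 3625502,
   3939028, 3939075, 3941182, 3941676, 3941750, 3941802, 3943597, 3944327, 3944750, 3944902, 3947876,
   3948002, 3948052, 3950446, 3950527, 3951002, 3952378, 3953530, 3953566, 3953603, 3953614, 3953656,
   3953703, 3953729, 3956660, 3957376, 3959186, 3959856, 3960528, 3962968, 3963008, 3963628, 3966129,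
   3966194, 3969282, 3969306, 3969329, 3969331, 3969356, 3969360, 3972412, 3972434, 3975564, 5911782,
   5912407, 5912482, 5921125, 6391206, 6391231, 6625606, 7486232, 878, 10128, 10876, 15885, 15948,
   16033, 16053, 27752, 29234, 34856, 47257, 47379, 61752, 82004, 82628, 84502, 86377, 87628, 87629,
   93933, 93938, 93943, 93947, 93951, 93953, 93954, 94054, 94059, 94068, 94074, 94075, 94175, 94180,
   94190, 94203, 94301, 94303, 94321, 94917, 109003, 109749, 113102, 113546, 114106, 114273, 117206,
   119898, 120523, 123023, 125407, 158257, 160128, 164501, 165127, 167003, 172049, 172068, 172084,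
   172200, 172426, 172441, 172754, 178376, 178698, 187776, 187902, 237754, 245752, 328450, 328676,
   394503, 406624, 408375, 410612, 422201, 422214, 422227, 422262, 422450, 437971, 475752, 475753,
   484519, 484650, 484651, 484997, 485250, 487351, 487750, 493958, 494272, 500302, 501606, 501773,
   502169, 516249, 562649, 562775, 569104, 578502, 656826, 719025, 734986, 797129, 797144, 797250,
   797375, 797376, 797670, 875264, 875375, 875377, 875385, 875445, 875500, 875501, 875503, 875506,
   875571, 953500, 953625, 953626, 959628, 969275, 969335, 985426, 1031625, 1031750, 1031751,
   1031756, 1033503, 1062926, 1109750, 1109875, 1109876, 1141051, 1183376, 1187877, 1187878, 1188003,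
   1188004, 1219166, 1221678, 1356503, 1359875, 1500250, 1578376, 1578501, 1578504, 1656677, 1656697,
   1656750, 1734807, 1750375, 1750412, 1891002, 1906751, 1969574, 1969626, 1969807, 1970281, 1970814,
   1970951, 1971434, 1971450, 1971578, 1972877, 1973003, 1973381, 1973401, 1975875, 1976000, 1976001,
   1976126, 1976127, 1976137, 1976147, 1976625, 1976626, 1976629, 1976751, 1976752, 1977250, 1977251,
   1977254, 1977376, 1977377, 1977397, 1977875, 1977876, 1978001, 1978002, 1978390, 1978501, 1978502,
   1978504, 1978516, 1978627, 1978628, 1979250, 1981628, 1981750, 1982376, 1984129, 1984702, 1984707,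
   1984728, 1984733, 1984774, 1984801, 1984812, 1984854, 1984866, 1984935, 1984959, 1984975, 1984980,
   1984990, 1984995, 1985961, 1986056, 1986061, 1986177, 1986197, 1986591, 1986677, 1986813, 1987782,
   1987787, 1987797, 1987878, 1987923, 1991001, 1991002, 1991004, 1991127, 1991128, 1991626, 1991627,
   1991750, 1991752, 1991753, 1992251, 1992252, 1992377, 1992378, 1992388, 1992876, 1992877, 1993002,
   1993003, 1993013, 1993501, 1993502, 1993627, 1993628, 1994250, 1994274, 1994750, 1997250, 1997876,
   1998002, 2000414, 2000430, 2000433, 2000438, 2000443, 2000448, 2000450, 2000454, 2000466, 2000470,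
   2000476, 2000486, 2000554, 2000556, 2000559, 2000564, 2000569, 2000574, 2000576, 2000602, 2000603,
   2001814, 2003553, 2006693, 2006698, 2006753, 2006754, 2006774, 2007376, 2007378, 2007379, 2008003,
   2008004, 2008024, 2008628, 2008629, 2009253, 2009254, 2009876, 2013002, 2013628, 2016180, 2016182,
   2016185, 2016190, 2016195, 2016200, 2016202, 2016229, 2016815, 2016830, 2017460, 2019304, 2062782,
   2063008, 2141128, 2219006, 2219027, 2219127, 2297204, 2312945, 2375393, 2375498, 2766096, 2766187,
   2767996, 2915850, 2937910, 3156535, 3156585, 3156761, 3158531, 3158621, 3159151, 3313001, 3562904,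
   3703501, 3703627, 3939653, 3939700, 3941009, 3941187, 3942301, 3942375, 3948501, 3948627, 3951627,
   3953003, 3953535, 3953571, 3953623, 3953624, 3956665, 3958566, 3961153, 3963013, 3964253, 3969365,
   3972439, 3975569, 4107395, 5910607, 5913047, 5914907, 5915532, 6391171, 6391211, 6391236, 651,
   866, 871, 3851, 3875, 4629, 9000, 13253, 15872, 15973, 16006, 16797, 18588, 23573, 24813, 31752,
   44214, 47267, 47282, 82244, 84625, 85753, 90753, 93958, 93963, 93968, 93976, 94100, 94326, 94346,
   109929, 113651, 125397, 125432, 126129, 141149, 158379, 160984, 167626, 168252, 170128, 172093,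
   172225, 172466, 187781, 190980, 191129, 207929, 248877, 259800, 266027, 297493, 315879, 328475,
   328701, 337925, 394798, 395254, 406653, 406754, 409000, 410382, 422219, 422226, 422267, 422352,
   422408, 422478, 422479, 423648, 473386, 475802, 476104, 481502, 484509, 484572, 484573, 484578,
   484603, 484693, 485174, 485209, 487034, 488484, 490876, 494001, 494028, 500402, 500428, 500483,
   500528, 500554, 502226, 513023, 562878, 563004, 578605, 641003, 641129, 656601, 656627, 656866,
   669886, 689328, 719128, 719254, 731052, 788379, 797015, 797878, 953376, 953502, 1037753, 1047400,
   1184001, 1187754, 1187769, 1187875, 1188001, 1204686, 1204898, 1219198, 1265889, 1266000, 1266002,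
   1266077, 1266097, 1266126, 1266128, 1266131, 1344125, 1344251, 1422250, 1422376, 1422381, 1438000,
   1500375, 1500501, 1578502, 1578503, 1578628, 1578629, 1595286, 1609261, 1656682, 1656687, 1656734,
   1657149, 1672400, 1672425, 1675523, 1734875, 1764252, 1766006, 1844252, 1890875, 1893502, 1969832,
   1969908, 1970906, 1970976, 1971603, 1971724, 1973008, 1973628, 1974006, 1974127, 1976002, 1976128,
   1976506, 1978656, 1979000, 1979126, 1979252, 1979262, 1979272, 1979751, 1979877, 1980376, 1980502,
   1980522, 1981001, 1981127, 1981629, 1981641, 1981753, 1982375, 1983001, 1984727, 1984732, 1984826,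
   1984837, 1984960, 1984984, 1985986, 1986004, 1986014, 1986081, 1986202, 1986600, 1986616, 1987351,
   1988087, 1991003, 1992375, 1994127, 1994129, 1994253, 1994752, 1994875, 1994878, 1995377, 1995503,
   1996002, 1996128, 1996627, 1996753, 1997375, 1997399, 1997875, 1998501, 1998627, 2000435, 2000439,
   2000455, 2000471, 2000475, 2000491, 2000495, 2000581, 2000601, 2003578, 2003593, 2003598, 2010501,
   2013001, 2013013, 2014253, 2016205, 2016207, 2016210, 2016215, 2016220, 2016225, 2016227, 2016855,
   2017485, 2052877, 2219253, 2297152, 2297252, 2375398, 2375493, 2844129, 3150955, 3156540, 3156831,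
   3188733, 3391126, 3787252, 3859877, 3941113, 3941629, 3942926, 3944952, 3947845, 3949126, 3949252,
   3951066, 3951152, 3953540, 3953608, 3953618, 3953619, 3953708, 3953734, 3956670, 3957946, 3959978,
   3966754, 3968629, 3969334, 3969370, 3975574, 4501146, 4501226, 4518727, 4829272, 5282396, 5299927,
   5673026, 5690527, 5911825, 5913065, 5918032, 5918657, 6391216, 6391241, 1378, 2532, 12000, 15378,
   47292, 47297, 47307, 47492, 80253, 82076, 82082, 82129, 82233, 82243, 87625, 88376, 88878, 91386,
   92626, 94329, 94351, 94371, 100266, 100618, 107128, 109908, 125457, 161226, 163653, 172491,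
   182208, 204879, 219322, 269253, 328726, 344152, 345286, 345578, 394501, 394502, 394549, 394599,
   394642, 394666, 394978, 400129, 440478, 473251, 473653, 473877, 474501, 474502, 475129, 478251,
   480751, 484532, 484533, 484537, 484538, 484539, 484542, 484543, 484554, 484583, 484588, 484593,
   484618, 484653, 484654, 484658, 484659, 484663, 484664, 484673, 484674, 484725, 484749, 484775,
   484779, 484780, 484784, 484785, 484789, 484790, 484794, 484799, 484900, 484905, 484906, 484910,
   484911, 484915, 484916, 485838, 487075, 489760, 493329, 494160, 497754, 497860, 500334, 500344,
   500455, 500508, 500555, 502167, 502353, 531774, 578746, 581100, 688014, 790753, 797020, 797267,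
   869503, 875134, 875477, 875497, 877879, 955379, 972854, 989952, 1031627, 1110379, 1187640,
   1266082, 1266087, 1344001, 1344127, 1578379, 1578394, 1656424, 1656627, 1656753, 1673411, 1734603,
   1813000, 1828505, 1844272, 1969753, 1969879, 1969949, 1971552, 1973000, 1974253, 1975491, 1975587,
   1976753, 1977131, 1977252, 1977877, 1979127, 1979129, 1979253, 1983626, 1984745, 1984824, 1984862,
   1984971, 1984985, 1986754, 1987796, 1988004, 1991629, 1994128, 1995500, 1997254, 1998000, 1999126,
   1999252, 2000440, 2000460, 2000464, 2000480, 2000496, 2000553, 2000558, 2000563, 2000573, 2000593,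
   2000606, 2000608, 2000619, 2013626, 2016184, 2016189, 2016232, 2016234, 2018651, 2019366, 2062787,
   2063013, 2297378, 2375488, 2689038, 3158425, 3178644, 3719164, 3738063, 3938649, 3941118, 3952877,
   3965503, 3971776, 3971801, 3971821, 3972471, 4098479, 4098725, 4101825, 4362401, 4363071, 5908032,
   6391176, 3598, 5254, 47317, 47322, 47332, 82196, 83253, 85129, 90266, 92003, 94308, 136751,
   158378, 160754, 167751, 168376, 192178, 203722, 238253, 320352, 327752, 376205, 394598, 397053,
   403375, 415894, 422453, 438092, 473379, 473646, 473701, 475125, 475128, 484675, 485218, 487125,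
   488481, 488648, 492079, 494043, 494355, 500301, 500327, 500352, 500470, 500575, 552129, 790754,
   812897, 875482, 875487, 891003, 891129, 953628, 1031453, 1109650, 1119004, 1125333, 1125550,
   1187645, 1187892, 1265824, 1422252, 1531756, 1734626, 1734752, 1844367, 1969531, 1969974, 1970611,
   1971577, 1974878, 1976526, 1977378, 1979878, 1980377, 1981002, 1982252, 1982254, 1982378, 1984996,
   1986629, 1987807, 1987812, 1987948, 1988112, 1990302, 1991129, 1994754, 1998625, 2000465, 2000483,
   2000485, 2000604, 2000614, 2000623, 2014254, 2014878, 2016171, 2016241, 2018026, 2019371, 2375483,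
   2765898, 2797416, 2797446, 2922254, 3156836, 3938644, 3941123, 3942254, 3953713, 3953739, 3968004,
   3969339, 3969349, 4019769, 4281801, 4281821, 4503001, 4503106, 4516232, 4893706, 4906832, 2852,
   2872, 7444, 16147, 18336, 21604, 26602, 26648, 26854, 27828, 47278, 47342, 47347, 47497, 80129,
   82169, 82248, 83021, 83101, 86378, 88254, 94333, 139876, 143725, 144349, 147449, 159003, 160909,
   161378, 167368, 170126, 170903, 171376, 201150, 394977, 405127, 425934, 426155, 473253, 473481,
   475754, 477649, 482768, 483887, 484656, 485875, 487120, 500613, 502436, 504275, 510550, 581860,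
   594241, 656551, 656553, 793879, 817398, 828616, 828621, 828678, 875224, 947011, 969103, 1203522,
   1266003, 1266129, 1344253, 1578270, 1812877, 1890893, 1891130, 1969999, 1971754, 1973406, 1978003,
   1979754, 1980503, 1983003, 1983502, 1984127, 1992254, 1994254, 1997879, 2000490, 2000613, 2015503,
   2016239, 2016244, 2063018, 3938518, 3938639, 4126202, 4266103, 4413627, 5910532, 5913032, 6313681,
   1244, 5879, 31600, 31631, 63056, 83878, 89503, 91427, 94358, 109751, 116825, 135511, 163951,
   164503, 170357, 171526, 189749, 194315, 316378, 406626, 422183, 423439, 476014, 481451, 484828,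
   484928, 487079, 490353, 490978, 500351, 500603, 522397, 523647, 530571, 531781, 578428, 790161,
   793259, 801215, 801220, 875159, 895979, 1297303, 1343896, 1344354, 1656628, 1656754, 1734878,
   1844277, 1970378, 1981128, 1982879, 1983628, 1987254, 1994876, 1995379, 2000584, 2009879, 2010504,
   2011754, 2012379, 2476146, 2476201, 3000379, 3172373, 3938513, 3938634, 3940477, 3942879, 3943601,
   3944876, 4424851, 4424907, 4434907, 4438028, 4440528, 4828673, 5516061, 5914273, 6003685, 6313691,
   6704315, 21688, 31636, 41125, 44189, 63061, 82086, 87003, 89001, 92628, 94115, 94151, 94365,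
   160254, 167628, 170524, 187876, 192233, 250376, 344193, 394873, 394944, 418428, 475127, 477002,
   478254, 481378, 484579, 484601, 484608, 484679, 484684, 484699, 484740, 484751, 484800, 484805,
   484815, 490918, 500326, 502350, 516222, 578433, 656576, 790156, 892975, 922451, 1047227, 1047273,
   1375433, 1734521, 1813005, 1971628, 1972751, 1973033, 1974031, 1980379, 1984253, 1986620, 1988629,
   1992879, 1995501, 1998001, 1998122, 1998504, 2003082, 2010476, 2010522, 2013082, 2016208, 2063023,
   2473021, 2473101, 2487477, 3938508, 3946126, 3950440, 3956187, 5911157, 5913657, 5916157, 6006810,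
   3472, 3479, 3497, 3748, 16751, 18441, 23477, 23548, 31641, 63066, 90128, 94090, 94176, 172276,
   266001, 266073, 316504, 406400, 478951, 481500, 484954, 494088, 500533, 562876, 788298, 875376,
   879335, 1069367, 1688651, 1973023, 1983504, 1988503, 1991754, 1996004, 1996126, 1997376, 1998626,
   2003107, 2007422, 2009856, 2009982, 2013057, 2013647, 2016213, 2016228, 2016233, 2018749, 2453503,
   2472477, 2706656, 2785476, 2859977, 3094352, 3188023, 3188048, 3323062, 3859902, 3939254, 3943504,
   3946751, 3953723, 5516681, 5910604, 5912479, 778, 21536, 31646, 31757, 34193, 36234, 36602, 36673,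
   44193, 82168, 82754, 93253, 94201, 109877, 167184, 172301, 172348, 344126, 359992, 394583, 394856,
   394994, 406752, 422876, 451145, 475836, 492078, 492704, 494280, 516116, 578481, 641001, 656613,
   875610, 953501, 1266001, 1584572, 1584759, 1584774, 1587288, 1971003, 1971129, 1976003, 1976148,
   1989254, 1991628, 1993504, 1994879, 1996751, 1999129, 1999251, 2000618, 2003556, 2004181, 2006056,
   2016218, 2016238, 2766035, 2869277, 2915354, 3939128, 4814782, 5203577, 5596652, 5597302, 5913674,
   5914282, 5916774, 5916782, 783, 3279, 31762, 85754, 93925, 94040, 94226, 94277, 100197, 100479,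
   109771, 170284, 172373, 188002, 328609, 334854, 406646, 427983, 476004, 476378, 478250, 482628,
   482647, 483878, 484877, 500578, 578431, 719126, 734814, 797377, 1031626, 1344126, 1584764,
   1584788, 1656626, 1976531, 1979128, 1979273, 1980273, 1989128, 1992379, 1994753, 1996629, 1999876,
   2000477, 2016243, 2078576, 2469181, 2531628, 2625457, 2687798, 2766040, 2767900, 2781747, 2861656,
   2863646, 3078398, 3939879, 3953582, 3957302, 3959999, 4262877, 5910433, 6144183, 888, 24101,
   24273, 31767, 88879, 93930, 94166, 94302, 162153, 172155, 172402, 187855, 191748, 266127, 406762,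
   409234, 412354, 473878, 478396, 481504, 484640, 484766, 484851, 487077, 487354, 500255, 502228,
   528636, 563002, 572754, 578405, 578493, 582227, 647358, 656694, 719854, 797271, 875502, 875585,
   1109751, 1188002, 1422251, 1734751, 1969850, 1975504, 1976628, 1979270, 1980893, 1982253, 1982398,
   1983398, 1986700, 1989879, 1992253, 1995504, 1999754, 2000482, 2078617, 2141075, 2156727, 2156737,
   2234852, 2241249, 2472927, 2766045, 2767915, 3159277, 3939753, 3955441, 5917407, 16729, 17328,
   31772, 47330, 84004, 93955, 94035, 94191, 94327, 113623, 172427, 265880, 344252, 395213, 406767,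
   418375, 484635, 493956, 494274, 496500, 516217, 578574, 641127, 734726, 953627, 1031601, 1187896,
   1266127, 1500376, 1578627, 1812876, 1978629, 1979753, 1982395, 1982423, 1984018, 1986715, 1986725,
   1989753, 1993004, 1995378, 2312956, 2443700, 2609753, 2767295, 2859806, 3156797, 3940504, 5916854,
   16477, 17076, 18583, 37398, 44834, 82193, 86379, 93980, 94060, 94216, 94352, 101148, 109897,
   344005, 406734, 406772, 478879, 479501, 483253, 516212, 578456, 719252, 797392, 875260, 1031752,
   1109726, 1344252, 1422201, 1656752, 1891001, 1971730, 1977156, 1977253, 1979323, 1981754, 1982250,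
   1982878, 1986095, 1986740, 1990504, 1992878, 1996129, 2453560, 3312875, 3940378, 6391183, 18331,
   22933, 26234, 89504, 94241, 94292, 111598, 239004, 406709, 407354, 416034, 484530, 484550, 484892,
   484977, 484983, 565281, 579726, 656606, 797045, 797397, 869504, 1109877, 1187636, 1188017,
   1189002, 1265885, 1422377, 1500326, 1516130, 1734877, 1812801, 1844902, 1906755, 1971483, 1976223,
   1980378, 1982875, 1986120, 1990378, 1993629, 1996003, 3250577, 3391000, 18436, 18609, 22934,
   29129, 94229, 94317, 109756, 165278, 178386, 191026, 317155, 344010, 422314, 423624, 484866,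
   488477, 489101, 494898, 501602, 502223, 502293, 505352, 646501, 651500, 872629, 1031606, 1188022,
   1189627, 1190207, 1265771, 1500502, 1656510, 1813002, 1973123, 1983500, 1983503, 1993503, 1996754,
   1998004, 2532798, 3469125, 26628, 50504, 94156, 94342, 95900, 109823, 110906, 187954, 187979,
   334626, 337707, 422319, 437898, 484756, 491773, 875261, 1120252, 1190252, 1656396, 1656535,
   1656629, 1891127, 1971588, 1984125, 1996628, 1997878, 1998629, 2600273, 4110526, 5916859, 1781,
   3500, 7876, 12936, 18357, 94061, 94181, 94367, 94902, 103386, 109666, 111526, 164653, 259587,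
   265890, 266079, 316288, 328326, 334636, 415832, 422324, 476379, 484730, 484965, 516115, 1042752,
   1265886, 1265935, 1344128, 1359754, 1578272, 1659208, 1971613, 1977878, 1998503, 2000607, 2006750,
   2600253, 5516032, 5521126, 2568, 8475, 94066, 94086, 94206, 94282, 96126, 109818, 172165, 172433,
   181467, 191152, 250479, 328351, 344204, 406457, 411148, 422146, 473375, 484882, 484992, 502368,
   503521, 580351, 729000, 875335, 965252, 1047253, 1578336, 1656511, 1734753, 1734754, 1981003,
   1999254, 2000525, 2000561, 2000582, 2008626, 2009875, 2144254, 2444013, 2764648, 2765268, 3953630,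
   3953666, 3954250, 3958626, 3959251, 4095923, 971, 15504, 94091, 94161, 94213, 94231, 94307,
   100246, 103347, 111678, 117826, 172190, 172458, 187770, 328604, 340886, 344298, 395875, 398250,
   406420, 407077, 414002, 423533, 484761, 501531, 503523, 797398, 953391, 1187736, 1272136, 1422253,
   1437879, 1976129, 1984128, 1986573, 1997440, 1999128, 2000530, 2000550, 2000566, 2000586, 2004250,
   2008001, 2009251, 2011751, 2013000, 3950545, 3953635, 3953671, 3953687, 3953712, 3953737, 3954875,
   4113021, 15820, 18457, 18487, 94116, 94186, 94238, 94332, 100231, 104002, 111703, 115966, 190930,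
   191051, 198008, 203736, 250573, 316131, 396500, 406546, 409036, 414627, 415847, 477004, 484645,
   484856, 487303, 1125378, 1187898, 1188023, 1659278, 1812878, 1812879, 1890886, 1979254, 1986598,
   1994340, 1997445, 2000535, 2000555, 2000571, 2000575, 2000591, 2000611, 2004875, 2006771, 2007375,
   2011126, 2012376, 2014876, 2016249, 2531754, 3953640, 3953692, 3955500, 13278, 15845, 94211,
   94357, 112866, 113436, 189298, 200548, 250598, 266173, 401375, 407387, 415252, 422167, 486541,
   487236, 490513, 494295, 501581, 503647, 875270, 1500378, 1506511, 1516004, 1578648, 1971609,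
   1976754, 1982379, 1986623, 1991240, 1994345, 1999879, 2000540, 2000560, 2000580, 2000592, 2000596,
   2000600, 2000616, 2005500, 2008000, 2009896, 2010500, 2014251, 2015501, 2287788, 3953645, 3953697,
   3956125, 4269256, 6082, 10729, 94236, 94287, 100534, 104627, 189323, 238749, 250568, 328441,
   422172, 484887, 484982, 486600, 490250, 493477, 495301, 500523, 1265895, 1272423, 1283049,
   1656425, 1891003, 1891004, 1979879, 1991245, 1999753, 2000545, 2000565, 2000585, 2000597, 2000605,
   2000617, 2000621, 2006125, 2008625, 2011125, 2013625, 2609879, 2765919, 4110546, 93987, 94312,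
   100549, 107424, 111173, 189348, 191177, 194348, 250593, 320506, 474578, 484861, 488391, 503648,
   506566, 729627, 1265825, 1656520, 1977379, 1983004, 2000570, 2000590, 2000610, 2000622, 2001196,
   2009250, 2011750, 2014250, 2765924, 2766170, 6126, 7896, 94337, 100484, 111224, 122423, 138045,
   160979, 191248, 404500, 484535, 484580, 501798, 502278, 503466, 506646, 506773, 652127, 875225,
   1656545, 1675398, 1980504, 2000595, 2000615, 2001221, 2012375, 2014875, 2766165, 2767174, 5501,
   94362, 399500, 406497, 484605, 494641, 500366, 502303, 502354, 503487, 509898, 574627, 950754,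
   1109878, 1265945, 1594298, 1656648, 1983629, 1985974, 2000620, 2001246, 2003061, 2015500, 2485577,
   2863701, 3966171, 4503006, 5531792, 22954, 82163, 275523, 484863, 484987, 487051, 487156, 501823,
   502246, 504348, 506772, 875345, 1031753, 1187862, 1260754, 1500503, 1985999, 1992380, 2003086,
   2016192, 3966166, 3969292, 3969297, 219925, 423497, 473173, 486550, 487161, 495875, 873254,
   1422378, 1891128, 1995505, 1997395, 2003111, 2003732, 2013061, 2016187, 2016197, 2016217, 2319876,
   4359992, 4657351, 219950, 405758, 406470, 487081, 487232, 489251, 500297, 1580806, 1813003,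
   1998630, 2009961, 2010502, 2016212, 2016222, 2763418, 2767784, 2767794, 3566132, 3961127, 3966137,
   190920, 219975, 474136, 481772, 485479, 502318, 1115806, 1659025, 1982218, 1986584, 1986594,
   2011127, 2013627, 2016237, 2016247, 2688004, 3961752, 405250, 475456, 487182, 1037762, 1578649,
   1656440, 1672418, 1978004, 1986609, 1986619, 2011752, 2014252, 3962377, 9510, 402625, 479504,
   485201, 486104, 487200, 489876, 491581, 493962, 502343, 512923, 513024, 516060, 1265840, 1656813,
   1812762, 1981129, 2012377, 2014877, 3943600, 394782, 486729, 493967, 500449, 875240, 1266213,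
   1984254, 2015502, 502192, 875613, 82188, 349878, 394787, 484004, 487459, 493377, 494938, 502217,
   502479, 506774, 522395, 478521, 492201, 502242, 516158, 1993625, 3943625, 405875, 492376, 525520,
   1993000, 1996750, 480129, 1051551, 1996125, 1999875, 336753, 485599, 493375, 512924, 1999250,
   2938001, 475729, 498401, 500296, 503642, 1979875, 1980500, 3078625, 475750, 484000, 493001,
   1981125, 1983000, 1983625, 85875, 478682, 1984250, 100241, 484957, 491516, 487106, 1034253, 35946,
   487186, 487226, 506767, 1422379, 2150375, 1047379, 1125504, 1813004, 1995375, 3946000, 100539,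
   100544, 487211, 1344254, 1500504, 1996000, 1998500, 3946625, 1734879, 1891129, 1996625, 1999125,
   504883, 1999750, 479146, 482271, 502428, 394961, 487202, 484612, 499627, 423472, 476375, 509899,
   528635, 477750, 502454, 480875, 479625]

/-- Pairs of basis vectors whose brackets generate the algebra. -/
def generationSteps : List ℕ :=
  [825, 850, 9475, 31, 56, 75, 100, 781, 806, 3925, 3950, 7100, 76, 105, 131, 136, 156, 201, 225,
   631, 632, 681, 727, 730, 732, 757, 761, 777, 807, 810, 812, 826, 835, 836, 852, 855, 857, 885,
   887, 892, 902, 906, 907, 932, 933, 935, 937, 938, 951, 961, 962, 977, 982, 987, 1387, 1388, 1389,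
   1390, 1391, 1392, 1393, 1416, 1417, 1418, 1435, 1436, 1450, 1451, 1460, 1461, 1462, 1480, 1482,
   1487, 3158, 3168, 3169, 3182, 3183, 3184, 3210, 3211, 3212, 3222, 3223, 3224, 3239, 3246, 3247,
   3248, 3923, 3929, 3930, 3935, 3941, 3948, 3951, 3957, 3962, 3975, 3977, 3980, 3982, 3984, 3987,
   3991, 6316, 6323, 6341, 6346, 6362, 6366, 6371, 7065, 7105, 4, 9, 95, 121, 129, 134, 203]

/-- Coordinates of cochains on which all coboundaries vanish. -/
def invariantKeys : List ℕ := [1531, 3601, 1021, 1583, 1384]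

/-- Coordinates of a linear map that are not needed to fix the gauge. -/
def freeKeys : List ℕ := [9412, 9450, 12600, 12523, 9394]

def finalMask : ℕ := learnAll jacN cocycleSteps (setAll invariantKeys (setAll gaugeKeys 0))

set_option maxRecDepth 100000 in
theorem triangular_gaugeKeys : triangular dhN gaugeKeys (setAll freeKeys 0) = true := by
  decide +kernel

set_option maxRecDepth 100000 in
theorem finalMask_covers :
    force finalMask (fun m => covers m 75 && (covers m 100 && covers m 6)) = true := by
  decide +kernel

set_option maxRecDepth 100000 in
theorem generate_full :
    force (generate generationSteps (setAll [75, 100, 6] 0)) (fun m => allBelow (bit m) 125) = true := by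
  decide +kernel

theorem graded_br :
    allBelow (fun i => allBelow (fun j => graded i j (br i j)) 125) 125 = true := by
  decide +kernel

section Propagation

variable (F : Type*) [Field F] {V : Type*} [AddCommGroup V] [Module F V]

/-- The value of a formal linear combination at a family of vectors. -/
def evalT (v : ℕ → V) (L : List (ℕ × ℕ)) : V := (L.map fun p => (p.2 : F) • v p.1).sum

@[simp] theorem evalT_nil (v : ℕ → V) : evalT F v [] = 0 := rfl

@[simp] theorem evalT_cons (v : ℕ → V) (p : ℕ × ℕ) (L : List (ℕ × ℕ)) :
    evalT F v (p :: L) = (p.2 : F) • v p.1 + evalT F v L := by simp [evalT]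

@[simp] theorem evalT_append (v : ℕ → V) (L L' : List (ℕ × ℕ)) :
    evalT F v (L ++ L') = evalT F v L + evalT F v L' := by simp [evalT]

theorem evalT_typesum (v : ℕ → V) (f : ℕ → List (ℕ × ℕ)) :
    evalT F v (typesum f) = ∑ t ∈ Finset.range 5, evalT F v (f t) := by
  simp [typesum, Finset.sum_range_succ, add_assoc]

theorem evalT_eq_zero {v : ℕ → V} {L : List (ℕ × ℕ)} (h : ∀ p ∈ L, v p.1 = 0) :
    evalT F v L = 0 := by
  induction L with
  | nil => rfl
  | cons p L ih => simp_all

theorem evalT_add (v w : ℕ → V) (L : List (ℕ × ℕ)) :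
    evalT F (fun k => v k + w k) L = evalT F v L + evalT F w L := by
  induction L with
  | nil => simp
  | cons p L ih => simp only [evalT_cons, ih, smul_add]; abel

theorem evalT_map {W : Type*} [AddCommGroup W] [Module F W] (f : V →ₗ[F] W) (v : ℕ → V)
    (L : List (ℕ × ℕ)) : f (evalT F v L) = evalT F (fun k => f (v k)) L := by
  induction L with
  | nil => simp
  | cons p L ih => simp [ih]

theorem force_eq {α : Type} (n : ℕ) (f : ℕ → α) : force n f = f n := by
  cases n <;> rfl

theorem bit_eq_testBit (m k : ℕ) : bit m k = m.testBit k := by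
  rw [Nat.testBit_eq_decide_div_mod_eq, bit, Nat.shiftRight_eq_div_pow]
  rw [Bool.eq_iff_iff]
  simp

theorem bit_insert (m u k : ℕ) : bit (m ||| (1 <<< u)) k = true ↔ bit m k = true ∨ k = u := by
  simp only [bit_eq_testBit, Nat.testBit_or, Nat.one_shiftLeft, Nat.testBit_two_pow,
    Bool.or_eq_true, decide_eq_true_eq, eq_comm (a := u)]

theorem bit_zero (k : ℕ) : bit 0 k = false := by simp [bit_eq_testBit]

theorem bit_setAll (L : List ℕ) (m k : ℕ) :
    bit (setAll L m) k = true ↔ bit m k = true ∨ k ∈ L := by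
  induction L generalizing m with
  | nil => simp [setAll]
  | cons n L ih => simp only [setAll, ih, bit_insert, List.mem_cons, or_assoc]

theorem evalT_rest {m u s : ℕ} {L : List (ℕ × ℕ)} {v : ℕ → V}
    (hv : ∀ k, bit m k = true → v k = 0) (h : rest m u s L ≠ 0) :
    (rest m u s L : F) • v u = (s : F) • v u + evalT F v L := by
  induction L generalizing s with
  | nil => simp [rest]
  | cons p L ih =>
    simp only [rest] at h ⊢
    cases hb : bit m p.1 with
    | true =>
      simp only [hb, cond_true] at h ⊢
      simp [ih h, hv _ hb]
    | false =>
      simp only [hb, cond_false] at h ⊢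
      cases hu : Nat.beq p.1 u with
      | false => simp [hu] at h
      | true =>
        simp only [hu, cond_true] at h ⊢
        rw [ih h, Nat.eq_of_beq_eq_true hu |>.symm]
        simp [add_smul, add_assoc]

variable [CharP F 5]

theorem learn_spec (V : Type*) [AddCommGroup V] [Module F V] (m : ℕ) (L : List (ℕ × ℕ)) :
    learn m L = m ∨ ∃ u, ∃ s : F, bit m u = false ∧ s ≠ 0 ∧ learn m L = m ||| (1 <<< u) ∧
      ∀ v : ℕ → V, (∀ k, bit m k = true → v k = 0) → evalT F v L = s • v u := by
  induction L with
  | nil => exact Or.inl rfl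
  | cons p L ih =>
    simp only [learn]
    cases hb : bit m p.1 with
    | true =>
      simp only [cond_true]
      refine ih.imp_right ?_
      rintro ⟨u, s, h1, h2, h3, h4⟩
      refine ⟨u, s, h1, h2, h3, fun v hv => ?_⟩
      simp [h4 v hv, hv _ hb]
    | false =>
      simp only [cond_false]
      cases hs : Nat.beq (rest m p.1 p.2 L % 5) 0 with
      | true => exact Or.inl rfl
      | false =>
        have hs' : rest m p.1 p.2 L % 5 ≠ 0 := Nat.ne_of_beq_eq_false hs
        refine Or.inr ⟨p.1, (rest m p.1 p.2 L : F), hb, ?_, rfl, fun v hv => ?_⟩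
        · rw [Ne, CharP.cast_eq_zero_iff F 5]
          omega
        · rw [evalT_rest F hv (by omega), evalT_cons]

theorem learn_sound {m : ℕ} {L : List (ℕ × ℕ)} {v : ℕ → V}
    (hv : ∀ k, bit m k = true → v k = 0) (hL : evalT F v L = 0) :
    ∀ k, bit (learn m L) k = true → v k = 0 := by
  intro k hk
  rcases learn_spec F V m L with h | ⟨u, s, -, hs, h, hev⟩
  · exact hv k (h ▸ hk)
  · rw [h, bit_insert] at hk
    rcases hk with hk | rfl
    · exact hv k hk
    · rw [hev v hv] at hL
      exact (smul_eq_zero.mp hL).resolve_left hs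

theorem learnAll_sound {D : ℕ → List (ℕ × ℕ)} {v : ℕ → V} (hD : ∀ n, evalT F v (D n) = 0)
    (L : List ℕ) {m : ℕ} (hv : ∀ k, bit m k = true → v k = 0) :
    ∀ k, bit (learnAll D L m) k = true → v k = 0 := by
  induction L generalizing m with
  | nil => exact hv
  | cons n L ih =>
    rw [learnAll, force_eq]
    exact ih (learn_sound F hv (hD n))

theorem generate_sound {v : ℕ → V}
    (hD : ∀ x y, v x = 0 → v y = 0 → evalT F v (br x y) = 0)
    (L : List ℕ) {m : ℕ} (hv : ∀ k, bit m k = true → v k = 0) :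
    ∀ k, bit (generate L m) k = true → v k = 0 := by
  induction L generalizing m with
  | nil => exact hv
  | cons n L ih =>
    rw [generate, force_eq]
    cases hb : bit m (n / 125) && bit m (n % 125) with
    | false => exact ih hv
    | true =>
      rw [Bool.and_eq_true] at hb
      exact ih (learn_sound F hv (hD _ _ (hv _ hb.1) (hv _ hb.2)))

theorem triangular_sound {D : ℕ → List (ℕ × ℕ)} (L : List ℕ) {m : ℕ}
    (hL : triangular D L m = true) (f : ℕ → F) :
    ∃ H : ℕ → F, (∀ k, bit m k = true → H k = 0) ∧ ∀ n ∈ L, evalT F H (D n) = f n := by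
  induction L generalizing m f with
  | nil => exact ⟨0, fun _ _ => rfl, by simp⟩
  | cons n L ih =>
    rw [triangular, force_eq] at hL
    cases hb : Nat.beq (learn m (D n)) m with
    | true => simp [hb] at hL
    | false =>
      simp only [hb, cond_false] at hL
      rcases learn_spec F F m (D n) with h | ⟨u, s, hu, hs, h, hev⟩
      · exact absurd h (Nat.ne_of_beq_eq_false hb)
      · let δ : ℕ → F := fun k => if k = u then f n / s else 0
        obtain ⟨H, hH, hHL⟩ := ih hL (fun k => f k - evalT F δ (D k))
        have hδ : ∀ k, bit m k = true → δ k = 0 := by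
          intro k hk
          simp only [δ]
          rw [if_neg]
          rintro rfl
          simp [hu] at hk
        have hHm : ∀ k, bit m k = true → H k = 0 := fun k hk =>
          hH k (by rw [h, bit_insert]; exact Or.inl hk)
        refine ⟨fun k => H k + δ k, fun k hk => by simp [hHm k hk, hδ k hk], fun k hk => ?_⟩
        rw [evalT_add]
        rcases List.mem_cons.mp hk with rfl | hk
        · rw [hev H hHm, hev δ hδ, hH u (by rw [h, bit_insert]; exact Or.inr rfl)]
          simp only [δ, if_true, smul_eq_mul]
          field_simp
          ring
        · rw [hHL k hk]
          ring

end Propagation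

theorem allBelow_sound {f : ℕ → Bool} {n : ℕ} (h : allBelow f n = true) {k : ℕ} (hk : k < n) :
    f k = true := by
  induction n with
  | zero => omega
  | succ n ih =>
    rw [allBelow, Bool.and_eq_true] at h
    rcases Nat.lt_succ_iff_lt_or_eq.mp hk with hk | rfl
    · exact ih h.2 hk
    · exact h.1

theorem covers_sound {m g b t : ℕ} (h : covers m g = true) (hb : b < 125) (ht : t < 5) :
    ∀ p ∈ cterm g b t 1, bit m p.1 = true := by
  have h1 := allBelow_sound (allBelow_sound h hb) ht
  unfold cterm at h1 ⊢
  cases hlt : Nat.blt g b <;> cases hgt : Nat.blt b g <;> simp_all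

theorem br_eq_nil {i j : ℕ} (h : 125 ≤ i ∨ 125 ≤ j) : br i j = [] := by
  simp only [br, force_eq]
  rcases h with h | h
  · obtain ⟨n, hn⟩ : ∃ n, i / 25 = n + 5 := ⟨i / 25 - 5, by omega⟩
    rw [hn]
    simp [brk]
  · obtain ⟨n, hn⟩ : ∃ n, j / 25 = n + 5 := ⟨j / 25 - 5, by omega⟩
    rw [hn]
    simp [brk]

theorem graded_sound {i j : ℕ} {L : List (ℕ × ℕ)} (h : graded i j L = true) :
    ∀ p ∈ L, p.1 < 125 ∧ w1 p.1 = (w1 i + w1 j) % 5 ∧ w2 p.1 = (w2 i + w2 j) % 5 := by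
  induction L with
  | nil => simp
  | cons p L ih =>
    simp only [graded, Bool.and_eq_true, Nat.blt_eq, Nat.beq_eq] at h
    intro q hq
    rcases List.mem_cons.mp hq with rfl | hq
    · exact ⟨h.1.1, h.1.2.1, h.1.2.2⟩
    · exact ih h.2 q hq

theorem weight_br {i j : ℕ} {p : ℕ × ℕ} (hp : p ∈ br i j) :
    p.1 < 125 ∧ w1 p.1 = (w1 i + w1 j) % 5 ∧ w2 p.1 = (w2 i + w2 j) % 5 := by
  by_cases h : 125 ≤ i ∨ 125 ≤ j
  · rw [br_eq_nil h] at hp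
    simp at hp
  · push Not at h
    exact graded_sound (allBelow_sound (allBelow_sound graded_br h.1) h.2) p hp

theorem w1_lt (n : ℕ) : w1 n < 5 := Nat.mod_lt _ (by norm_num)

theorem w2_lt (n : ℕ) : w2 n < 5 := Nat.mod_lt _ (by norm_num)

theorem ix_congr {u v u' v' : ℕ} (hu : u % 5 = u' % 5) (hv : v % 5 = v' % 5) (t : ℕ) :
    ix u v t = ix u' v' t := by
  simp only [ix]
  omega

theorem ix_w {m : ℕ} : ix (w1 m) (w2 m) (m / 25) = m := by
  have h1 : (w1 m + 4 * sh1 (m / 25)) % 5 = m / 5 % 5 := by simp only [w1]; omega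
  have h2 : (w2 m + 4 * sh2 (m / 25)) % 5 = m % 5 := by simp only [w2]; omega
  rw [ix, h1, h2]
  omega

theorem ix_div (u v t : ℕ) : ix u v t / 25 = t := by
  simp only [ix]
  omega

theorem ix_lt {t : ℕ} (u v : ℕ) (ht : t < 5) : ix u v t < 125 := by
  simp only [ix]
  omega

theorem w1_ix (u v t : ℕ) : w1 (ix u v t) = u % 5 := by
  rw [w1, ix_div]
  simp only [ix]
  omega

theorem w2_ix (u v t : ℕ) : w2 (ix u v t) = v % 5 := by
  rw [w2, ix_div]
  simp only [ix]
  omega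

theorem sum_eq_sum_ix {V : Type*} [AddCommMonoid V] (f : ℕ → V) (u v : ℕ)
    (hf : ∀ m < 125, f m ≠ 0 → w1 m = u % 5 ∧ w2 m = v % 5) :
    ∑ m ∈ Finset.range 125, f m = ∑ t ∈ Finset.range 5, f (ix u v t) := by
  symm
  refine Finset.sum_of_injOn (fun t => ix u v t) ?_ ?_ ?_ fun _ _ => rfl
  · intro s _ t _ h
    have := congrArg (· / 25) h
    simpa [ix_div] using this
  · intro t ht
    simp only [Finset.coe_range, Set.mem_Iio] at ht ⊢
    exact ix_lt u v ht
  · intro m hm hm'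
    by_contra h
    rw [Finset.mem_range] at hm
    obtain ⟨h1, h2⟩ := hf m hm h
    refine hm' ⟨m / 25, by simp; omega, ?_⟩
    have := @ix_w m
    rw [h1, h2] at this
    exact (ix_congr (by omega) (by omega) _).trans this

theorem four_eq_neg_one (F : Type*) [Field F] [CharP F 5] : (4 : F) = -1 := by
  have h : ((5 : ℕ) : F) = 0 := CharP.cast_eq_zero F 5
  push_cast at h
  linear_combination h

section Frame

variable {F : Type*} [Field F] {M : Type*} [LieRing M] [LieAlgebra F M]

/-- A basis `e 0, …, e 124` with coordinate functions `co k` in which the structure constants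
are those of the Melikian algebra. -/
structure IsMelikianBasis (e : ℕ → M) (co : ℕ → M →ₗ[F] F) : Prop where
  co_e : ∀ i k, k < 125 → co k (e i) = if i = k then 1 else 0
  expand : ∀ m, m = ∑ k ∈ Finset.range 125, co k m • e k
  lie : ∀ i j, ⁅e i, e j⁆ = evalT F e (br i j)

theorem evalT_pick {V : Type*} [AddCommGroup V] [Module F V] (v : ℕ → V) (l : ℕ)
    (f : ℕ → List (ℕ × ℕ)) (a : V) (hf : ∀ c, evalT F v (f c) = (c : F) • a)
    (L : List (ℕ × ℕ)) :
    evalT F v (pick l f L) = evalT F (fun k => if k = l then (1 : F) else 0) L • a := by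
  induction L with
  | nil => simp [pick]
  | cons p L ih =>
    rw [pick]
    cases h : Nat.beq p.1 l with
    | true =>
      rw [cond_true, evalT_append, ih, hf, evalT_cons, Nat.eq_of_beq_eq_true h]
      simp [add_smul]
    | false =>
      rw [cond_false, ih, evalT_cons, if_neg (Nat.ne_of_beq_eq_false h)]
      simp

namespace IsMelikianBasis

variable {e : ℕ → M} {co : ℕ → M →ₗ[F] F} (B : IsMelikianBasis e co)
include B

theorem co_evalT {l : ℕ} (hl : l < 125) (L : List (ℕ × ℕ)) :
    co l (evalT F e L) = evalT F (fun k => if k = l then (1 : F) else 0) L := by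
  rw [evalT_map]
  simp only [B.co_e _ l hl]

theorem ext_co {m m' : M} (h : ∀ k < 125, co k m = co k m') : m = m' := by
  rw [B.expand m, B.expand m']
  exact Finset.sum_congr rfl fun k hk => by rw [h k (Finset.mem_range.mp hk)]

theorem co_lie_ne_zero {i m l : ℕ} (hl : l < 125) (h : co l ⁅e i, e m⁆ ≠ 0) :
    w1 l = (w1 i + w1 m) % 5 ∧ w2 l = (w2 i + w2 m) % 5 := by
  by_contra hw
  refine h ?_
  rw [B.lie, B.co_evalT hl]
  refine evalT_eq_zero F fun p hp => if_neg ?_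
  rintro rfl
  exact hw (weight_br hp).2

theorem co_lie {l : ℕ} (x m : M) :
    co l ⁅x, m⁆ = ∑ k ∈ Finset.range 125, co k m * co l ⁅x, e k⁆ := by
  conv_lhs => rw [B.expand m]
  simp [lie_sum]

theorem exists_linearMap (H : ℕ → ℕ → F) :
    ∃ h : M →ₗ[F] M, ∀ i < 125, ∀ k < 125, co k (h (e i)) = H i k := by
  refine ⟨∑ i ∈ Finset.range 125, (co i).smulRight (∑ k ∈ Finset.range 125, H i k • e k), ?_⟩
  intro i hi k hk
  have h1 : ∀ j ∈ Finset.range 125, (co j (e i)) • (∑ k ∈ Finset.range 125, H j k • e k) =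
      if i = j then ∑ k ∈ Finset.range 125, H j k • e k else 0 := fun j hj => by
    rw [B.co_e i j (Finset.mem_range.mp hj)]
    split_ifs <;> simp
  simp only [LinearMap.sum_apply, LinearMap.smulRight_apply]
  rw [Finset.sum_congr rfl h1, Finset.sum_ite_eq, if_pos (Finset.mem_range.mpr hi), map_sum,
    Finset.sum_eq_single k]
  · simp [B.co_e k k hk]
  · intro j _ hjk
    simp [B.co_e j k hk, hjk]
  · simp [hk]

theorem evalT_dhHalf {h : M →ₗ[F] M} {H : ℕ → F}
    (hH : ∀ i < 125, ∀ k < 125, H (i * 125 + k) = co k (h (e i))) (s : ℕ) {x y l : ℕ}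
    (hy : y < 125) (hl : l < 125) :
    evalT F H (dhHalf s x y l) = s * co l ⁅e x, h (e y)⁆ := by
  rw [dhHalf, evalT_typesum, B.co_lie, sum_eq_sum_ix _ (w1 l + 4 * w1 x) (w2 l + 4 * w2 x),
    Finset.mul_sum]
  · refine Finset.sum_congr rfl fun t ht => ?_
    have hm := ix_lt (w1 l + 4 * w1 x) (w2 l + 4 * w2 x) (Finset.mem_range.mp ht)
    rw [force_eq, evalT_pick H l _ (s * co (ix (w1 l + 4 * w1 x) (w2 l + 4 * w2 x) t) (h (e y))),
      ← B.co_evalT hl, ← B.lie, smul_eq_mul]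
    · ring
    · intro c
      simp only [evalT_cons, evalT_nil, hH y hy _ hm, smul_eq_mul]
      push_cast
      ring
  · intro m _ hm0
    have h1 := B.co_lie_ne_zero hl (right_ne_zero_of_mul hm0)
    have h2 := w1_lt m
    have h3 := w2_lt m
    omega

variable [CharP F 5]

omit B in
theorem evalT_dhTail {h : M →ₗ[F] M} {H : ℕ → F}
    (hH : ∀ i < 125, ∀ k < 125, H (i * 125 + k) = co k (h (e i))) {l : ℕ} (hl : l < 125)
    {L : List (ℕ × ℕ)} (hL : ∀ p ∈ L, p.1 < 125) :
    evalT F H (dhTail l L) = - co l (h (evalT F e L)) := by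
  induction L with
  | nil => simp [dhTail]
  | cons p L ih =>
    rw [dhTail, evalT_cons, ih fun q hq => hL q (List.mem_cons_of_mem _ hq)]
    simp only [hH _ (hL p List.mem_cons_self) l hl, evalT_cons, map_add, map_smul, smul_eq_mul]
    push_cast
    rw [four_eq_neg_one F]
    ring

theorem co_coboundary {h : M →ₗ[F] M} {H : ℕ → F}
    (hH : ∀ i < 125, ∀ k < 125, H (i * 125 + k) = co k (h (e i))) {x y l : ℕ}
    (hx : x < 125) (hy : y < 125) (hl : l < 125) :
    co l (⁅e x, h (e y)⁆ - ⁅e y, h (e x)⁆ - h ⁅e x, e y⁆) = evalT F H (dhTerms x y l) := by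
  rw [dhTerms, evalT_append, evalT_append, B.evalT_dhHalf hH 1 hy hl, B.evalT_dhHalf hH 4 hx hl,
    evalT_dhTail hH hl fun p hp => (weight_br hp).1, ← B.lie]
  push_cast
  rw [four_eq_neg_one F, map_sub, map_sub]
  ring

end IsMelikianBasis

end Frame

section Cochain

variable {F : Type*} [Field F] {M : Type*} [LieRing M] [LieAlgebra F M]

/-- Alternating bilinear `2`-cocycles with adjoint coefficients. -/
structure IsCocycle (c : M →ₗ[F] M →ₗ[F] M) : Prop where
  self : ∀ x, c x x = 0
  jacobi : ∀ x y z, ⁅x, c y z⁆ + ⁅y, c z x⁆ + ⁅z, c x y⁆ +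
      c x ⁅y, z⁆ + c y ⁅z, x⁆ + c z ⁅x, y⁆ = 0

theorem IsCocycle.swap {c : M →ₗ[F] M →ₗ[F] M} (hc : IsCocycle c) (x y : M) :
    c x y = - c y x := by
  have h := hc.self (x + y)
  simp only [map_add, LinearMap.add_apply, hc.self, zero_add, add_zero] at h
  exact eq_neg_of_add_eq_zero_right h

theorem IsCocycle.sub {c d : M →ₗ[F] M →ₗ[F] M} (hc : IsCocycle c) (hd : IsCocycle d) :
    IsCocycle (c - d) where
  self x := by simp [hc.self, hd.self]
  jacobi x y z := by
    have h1 := hc.jacobi x y z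
    have h2 := hd.jacobi x y z
    rw [← sub_eq_zero.mpr (h1.trans h2.symm)]
    simp only [LinearMap.sub_apply, lie_sub]
    abel

theorem IsCocycle.smul {c : M →ₗ[F] M →ₗ[F] M} (hc : IsCocycle c) (a : F) :
    IsCocycle (a • c) where
  self x := by simp [hc.self]
  jacobi x y z := by
    rw [← smul_zero a, ← hc.jacobi x y z]
    simp only [LinearMap.smul_apply, lie_smul, smul_add]

/-- The coboundary of a linear map. -/
def coboundary (h : M →ₗ[F] M) : M →ₗ[F] M →ₗ[F] M :=
  LinearMap.mk₂ F (fun x y => ⁅x, h y⁆ - ⁅y, h x⁆ - h ⁅x, y⁆)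
    (fun x x' y => by simp only [add_lie, map_add, lie_add]; abel)
    (fun a x y => by simp only [smul_lie, map_smul, lie_smul, smul_sub])
    (fun x y y' => by simp only [add_lie, map_add, lie_add]; abel)
    (fun a x y => by simp only [smul_lie, map_smul, lie_smul, smul_sub])

@[simp] theorem coboundary_apply (h : M →ₗ[F] M) (x y : M) :
    coboundary h x y = ⁅x, h y⁆ - ⁅y, h x⁆ - h ⁅x, y⁆ := rfl

theorem coboundary_add (h h' : M →ₗ[F] M) :
    coboundary (h + h') = coboundary h + coboundary h' := by
  ext x y
  simp only [coboundary_apply, LinearMap.add_apply, lie_add]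
  abel

theorem isCocycle_coboundary (h : M →ₗ[F] M) : IsCocycle (coboundary h) where
  self x := by simp
  jacobi x y z := by
    have h1 := congrArg h (lie_jacobi x y z)
    have h2 := lie_lie x y (h z)
    have h3 := lie_lie y z (h x)
    have h4 := lie_lie z x (h y)
    simp only [map_add, map_zero] at h1
    simp only [coboundary_apply, lie_sub, h2, h3, h4]
    rw [← neg_eq_zero, ← h1]
    abel

namespace IsMelikianBasis

variable {e : ℕ → M} {co : ℕ → M →ₗ[F] F} (B : IsMelikianBasis e co)

/-- The coordinates of a cochain that have weight zero. -/
def coords (e : ℕ → M) (co : ℕ → M →ₗ[F] F) (c : M →ₗ[F] M →ₗ[F] M) (n : ℕ) : F :=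
  co (ix (w1 (n / 625 % 125) + w1 (n / 5 % 125)) (w2 (n / 625 % 125) + w2 (n / 5 % 125)) (n % 5))
    (c (e (n / 625 % 125)) (e (n / 5 % 125)))

theorem coords_ckey (c : M →ₗ[F] M →ₗ[F] M) {i j t : ℕ} (hi : i < 125) (hj : j < 125) (ht : t < 5) :
    coords e co c (ckey i j t) = co (ix (w1 i + w1 j) (w2 i + w2 j) t) (c (e i) (e j)) := by
  have h1 : ckey i j t / 625 % 125 = i := by simp only [ckey]; omega
  have h2 : ckey i j t / 5 % 125 = j := by simp only [ckey]; omega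
  have h3 : ckey i j t % 5 = t := by simp only [ckey]; omega
  rw [coords, h1, h2, h3]

theorem coords_sub (c d : M →ₗ[F] M →ₗ[F] M) (n : ℕ) :
    coords e co (c - d) n = coords e co c n - coords e co d n := by
  simp [coords]

variable [CharP F 5] {c : M →ₗ[F] M →ₗ[F] M}

theorem evalT_cterm (hc : IsCocycle c) {i j t : ℕ} (hi : i < 125) (hj : j < 125) (ht : t < 5)
    (a : ℕ) : evalT F (coords e co c) (cterm i j t a) =
      (a : F) • co (ix (w1 i + w1 j) (w2 i + w2 j) t) (c (e i) (e j)) := by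
  rw [cterm]
  cases hlt : Nat.blt i j with
  | true => simp [coords_ckey c hi hj ht]
  | false =>
    cases hgt : Nat.blt j i with
    | true =>
      rw [cond_false, cond_true, evalT_cons, evalT_nil, coords_ckey c hj hi ht, hc.swap (e i) (e j),
        add_comm (w1 j), add_comm (w2 j), map_neg]
      push_cast
      rw [four_eq_neg_one F]
      simp only [smul_eq_mul]
      ring
    | false =>
      have : i = j := by
        rw [← Bool.not_eq_true, Nat.blt_eq] at hlt hgt
        omega
      simp [this, hc.self]

/-- Cochains of weight zero for the torus. -/
def Balanced (e : ℕ → M) (co : ℕ → M →ₗ[F] F) (c : M →ₗ[F] M →ₗ[F] M) : Prop :=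
  ∀ i < 125, ∀ j < 125, ∀ l < 125, co l (c (e i) (e j)) ≠ 0 →
    w1 l = (w1 i + w1 j) % 5 ∧ w2 l = (w2 i + w2 j) % 5

theorem evalT_push (hc : IsCocycle c) {x t u v : ℕ} (hx : x < 125) (ht : t < 5)
    {L : List (ℕ × ℕ)} (hL : ∀ p ∈ L, p.1 < 125 ∧ w1 p.1 = u % 5 ∧ w2 p.1 = v % 5) :
    evalT F (coords e co c) (push x t L) =
      co (ix (w1 x + u) (w2 x + v) t) (c (e x) (evalT F e L)) := by
  induction L with
  | nil => simp [push]
  | cons p L ih =>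
    obtain ⟨h1, h2, h3⟩ := hL p List.mem_cons_self
    rw [push, evalT_append, ih fun q hq => hL q (List.mem_cons_of_mem _ hq),
      evalT_cterm hc hx h1 ht, evalT_cons, map_add, map_smul, map_add, map_smul,
      ix_congr (u := w1 x + w1 p.1) (u' := w1 x + u) (v := w2 x + w2 p.1) (v' := w2 x + v)
        (by omega) (by omega)]

include B

theorem evalT_half (hc : IsCocycle c) (hb : Balanced e co c) {x y z t l u v : ℕ}
    (hx : x < 125) (hy : y < 125) (hz : z < 125) (ht : t < 5)
    (hu : u = w1 y + w1 z) (hv : v = w2 y + w2 z)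
    (hl : l = ix (w1 x + u) (w2 x + v) t) :
    evalT F (coords e co c) (half x y z t l u v) =
      co l (⁅e x, c (e y) (e z)⁆ + c (e x) ⁅e y, e z⁆) := by
  have hl' : l < 125 := hl ▸ ix_lt _ _ ht
  simp only [half, force_eq]
  rw [evalT_append, evalT_typesum, evalT_push hc hx ht (u := u) (v := v)
    (fun p hp => by rw [hu, hv]; exact weight_br hp), ← B.lie, ← hl, map_add,
    B.co_lie, sum_eq_sum_ix _ u v]
  · congr 1
    refine Finset.sum_congr rfl fun s hs => ?_
    rw [evalT_pick _ l _ _ (fun a => evalT_cterm hc hy hz (Finset.mem_range.mp hs) a),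
      ← B.co_evalT hl', ← B.lie, smul_eq_mul, mul_comm, hu, hv]
  · intro m hm hm0
    rw [hu, hv]
    exact hb y hy z hz m hm (left_ne_zero_of_mul hm0)

theorem evalT_jac (hc : IsCocycle c) (hb : Balanced e co c) {x y z t : ℕ}
    (hx : x < 125) (hy : y < 125) (hz : z < 125) (ht : t < 5) :
    evalT F (coords e co c) (jac x y z t) = 0 := by
  simp only [jac, force_eq]
  rw [evalT_append, evalT_append,
    evalT_half B hc hb hx hy hz ht rfl rfl (ix_congr (by omega) (by omega) _),
    evalT_half B hc hb hy hz hx ht rfl rfl (ix_congr (by omega) (by omega) _),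
    evalT_half B hc hb hz hx hy ht rfl rfl (ix_congr (by omega) (by omega) _),
    ← map_add, ← map_add]
  refine Eq.trans (congrArg _ ?_) (map_zero _)
  rw [← hc.jacobi (e x) (e y) (e z)]
  abel

theorem evalT_jacN (hc : IsCocycle c) (hb : Balanced e co c) (n : ℕ) :
    evalT F (coords e co c) (jacN n) = 0 := by
  simp only [jacN, force_eq]
  exact evalT_jac B hc hb (Nat.mod_lt _ (by norm_num)) (Nat.mod_lt _ (by norm_num))
    (Nat.mod_lt _ (by norm_num)) (Nat.mod_lt _ (by norm_num))

/-- A cocycle of weight zero that vanishes at the gauge coordinates and at the invariant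
coordinates is zero. -/
theorem eq_zero_of_coords (hc : IsCocycle c) (hb : Balanced e co c)
    (h1 : ∀ n ∈ gaugeKeys, coords e co c n = 0) (h2 : ∀ n ∈ invariantKeys, coords e co c n = 0) :
    c = 0 := by
  have hm : ∀ k, bit finalMask k = true → coords e co c k = 0 := by
    refine learnAll_sound F (evalT_jacN B hc hb) _ fun k hk => ?_
    rw [bit_setAll, bit_setAll, bit_zero] at hk
    rcases hk with (hk | hk) | hk
    · simp at hk
    · exact h1 k hk
    · exact h2 k hk
  have hcov := finalMask_covers
  rw [force_eq, Bool.and_eq_true, Bool.and_eq_true] at hcov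
  have hg : ∀ g < 125, covers finalMask g = true → c (e g) = 0 := by
    intro g hg hcov
    have h3 : ∀ b < 125, c (e g) (e b) = 0 := by
      intro b hb'
      refine B.ext_co fun k hk => ?_
      rw [map_zero]
      by_contra h0
      obtain ⟨hw1, hw2⟩ := hb g hg b hb' k hk h0
      have ht : k / 25 < 5 := by omega
      have h4 := evalT_cterm (e := e) (co := co) hc hg hb' ht 1
      rw [evalT_eq_zero F fun p hp => hm _ (covers_sound hcov hb' ht p hp),
        ← ix_congr (u := w1 k) (v := w2 k) (by omega) (by omega), ix_w] at h4
      simp only [Nat.cast_one, one_smul] at h4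
      exact h0 h4.symm
    ext y
    rw [LinearMap.zero_apply, B.expand y, map_sum]
    exact Finset.sum_eq_zero fun b hb' => by rw [map_smul, h3 b (Finset.mem_range.mp hb'), smul_zero]
  have hgen : ∀ k, bit (generate generationSteps (setAll [75, 100, 6] 0)) k = true →
      c (e k) = 0 := by
    refine generate_sound F (v := fun k => c (e k)) (fun x y hx hy => ?_) _ fun k hk => ?_
    · rw [← evalT_map F c, ← B.lie]
      ext z
      have hx' : ∀ w, c w (e x) = 0 := fun w => by rw [hc.swap, hx]; simp
      have := hc.jacobi (e x) (e y) z
      simp only [hx, hy, hx', LinearMap.zero_apply, lie_zero, add_zero, zero_add] at this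
      rw [hc.swap, this, neg_zero, LinearMap.zero_apply]
    · rw [bit_setAll, bit_zero] at hk
      simp only [Bool.false_eq_true, List.mem_cons, List.not_mem_nil, or_false, false_or] at hk
      rcases hk with rfl | rfl | rfl
      · exact hg _ (by norm_num) hcov.1
      · exact hg _ (by norm_num) hcov.2.1
      · exact hg _ (by norm_num) hcov.2.2
  have hfull := generate_full
  rw [force_eq] at hfull
  ext x y
  rw [LinearMap.zero_apply, LinearMap.zero_apply, B.expand x, map_sum, LinearMap.sum_apply]
  refine Finset.sum_eq_zero fun k hk => ?_
  rw [map_smul, hgen k (allBelow_sound hfull (Finset.mem_range.mp hk))]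
  simp

end IsMelikianBasis

end Cochain

theorem br_torus {i : ℕ} (hi : i < 125) :
    br 30 i = (if w1 i = 0 then [] else [(i, w1 i)]) ∧
      br 51 i = (if w2 i = 0 then [] else [(i, w2 i)]) := by
  revert i
  decide +kernel

theorem dhN_invariantKeys : ∀ n ∈ invariantKeys, dhN n = [] := by
  decide +kernel

section Reduction

variable {F : Type*} [Field F] {M : Type*} [LieRing M] [LieAlgebra F M]

namespace IsMelikianBasis

variable {e : ℕ → M} {co : ℕ → M →ₗ[F] F} (B : IsMelikianBasis e co) [CharP F 5]

theorem cast_weight_iff {a b c : ℕ} (ha : a < 5) :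
    (a : F) = b + c ↔ a = (b + c) % 5 := by
  rw [← Nat.cast_add, CharP.cast_eq_iff_mod_eq F 5, Nat.mod_eq_of_lt ha]

include B

theorem coords_coboundary (h : M →ₗ[F] M) (n : ℕ) :
    coords e co (coboundary h) n =
      evalT F (fun k => co (k % 125) (h (e (k / 125)))) (dhN n) := by
  simp only [coords, dhN, force_eq, coboundary_apply]
  refine B.co_coboundary (fun i hi k hk => ?_) (Nat.mod_lt _ (by norm_num))
    (Nat.mod_lt _ (by norm_num)) (ix_lt _ _ (Nat.mod_lt _ (by norm_num)))
  rw [show (i * 125 + k) % 125 = k by omega, show (i * 125 + k) / 125 = i by omega]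

theorem coords_coboundary_invariantKeys (h : M →ₗ[F] M) {n : ℕ} (hn : n ∈ invariantKeys) :
    coords e co (coboundary h) n = 0 := by
  rw [B.coords_coboundary, dhN_invariantKeys n hn, evalT_nil]

theorem exists_gauge (c : M →ₗ[F] M →ₗ[F] M) :
    ∃ h : M →ₗ[F] M, ∀ n ∈ gaugeKeys, coords e co (coboundary h) n = coords e co c n := by
  obtain ⟨H, -, hH⟩ := triangular_sound F _ triangular_gaugeKeys (coords e co c)
  obtain ⟨h, hh⟩ := B.exists_linearMap fun i k => H (i * 125 + k)
  refine ⟨h, fun n hn => ?_⟩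
  rw [← hH n hn]
  simp only [coords, dhN, force_eq, coboundary_apply]
  exact B.co_coboundary (fun i hi k hk => (hh i hi k hk).symm) (Nat.mod_lt _ (by norm_num))
    (Nat.mod_lt _ (by norm_num)) (ix_lt _ _ (Nat.mod_lt _ (by norm_num)))

omit [CharP F 5] in
theorem lie_torus {i : ℕ} (hi : i < 125) :
    ⁅e 30, e i⁆ = (w1 i : F) • e i ∧ ⁅e 51, e i⁆ = (w2 i : F) • e i := by
  rw [B.lie, B.lie, (br_torus hi).1, (br_torus hi).2]
  constructor <;> split_ifs with h <;> simp [h]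

omit [CharP F 5] in
/-- A cocycle is, up to the weight, the coboundary of its contraction with a torus element. -/
theorem weight_mul_co {c : M →ₗ[F] M →ₗ[F] M} (hc : IsCocycle c) {τ : M} {w : ℕ → F}
    (hτ : ∀ i < 125, ⁅τ, e i⁆ = w i • e i) {i j l : ℕ} (hi : i < 125) (hj : j < 125)
    (hl : l < 125) :
    (w l - w i - w j) * co l (c (e i) (e j)) = co l (coboundary (c τ) (e i) (e j)) := by
  have h1 : ∀ m, co l ⁅τ, m⁆ = w l * co l m := by
    intro m
    rw [B.co_lie, Finset.sum_eq_single l]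
    · rw [hτ l hl, map_smul, B.co_e l l hl, if_pos rfl, smul_eq_mul]
      ring
    · intro k hk hkl
      rw [hτ k (Finset.mem_range.mp hk), map_smul, B.co_e k l hl, if_neg hkl, smul_zero, mul_zero]
    · exact fun h => absurd (Finset.mem_range.mpr hl) h
  have h2 := congrArg (co l) (hc.jacobi τ (e i) (e j))
  rw [← lie_skew (e j) τ, hτ i hi, hτ j hj, hc.swap (e j) τ,
    hc.swap (e j) (w i • e i)] at h2
  simp only [map_add, h1, map_neg, lie_neg, map_smul, LinearMap.smul_apply, smul_eq_mul,
    map_zero] at h2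
  simp only [coboundary_apply, map_sub]
  linear_combination h2

theorem co_coboundary_congr {h h' : M →ₗ[F] M} {s α β : F}
    (hh : ∀ i < 125, ∀ k < 125, (w1 k : F) - w1 i = α → (w2 k : F) - w2 i = β →
      co k (h (e i)) = s * co k (h' (e i))) {i j l : ℕ} (hi : i < 125) (hj : j < 125)
    (hl : l < 125) (hα : (w1 l : F) - w1 i - w1 j = α) (hβ : (w2 l : F) - w2 i - w2 j = β) :
    co l (coboundary h (e i) (e j)) = s * co l (coboundary h' (e i) (e j)) := by
  have key : ∀ i < 125, ∀ j < 125, (w1 l : F) - w1 i - w1 j = α →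
      (w2 l : F) - w2 i - w2 j = β → co l ⁅e i, h (e j)⁆ = s * co l ⁅e i, h' (e j)⁆ := by
    intro i hi j hj hα hβ
    rw [B.co_lie, B.co_lie (e i) (h' (e j)), Finset.mul_sum]
    refine Finset.sum_congr rfl fun k hk => ?_
    by_cases h0 : co l ⁅e i, e k⁆ = 0
    · simp [h0]
    · obtain ⟨hw1, hw2⟩ := B.co_lie_ne_zero hl h0
      rw [← cast_weight_iff (F := F) (w1_lt l)] at hw1
      rw [← cast_weight_iff (F := F) (w2_lt l)] at hw2
      rw [hh j hj k (Finset.mem_range.mp hk) (by rw [← hα, hw1]; ring)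
        (by rw [← hβ, hw2]; ring), mul_assoc]
  have key' : co l (h ⁅e i, e j⁆) = s * co l (h' ⁅e i, e j⁆) := by
    rw [B.expand ⁅e i, e j⁆, map_sum, map_sum, map_sum, map_sum, Finset.mul_sum]
    refine Finset.sum_congr rfl fun k hk => ?_
    have hk' := Finset.mem_range.mp hk
    simp only [map_smul, smul_eq_mul]
    by_cases h0 : co k ⁅e i, e j⁆ = 0
    · simp [h0]
    · obtain ⟨hw1, hw2⟩ := B.co_lie_ne_zero hk' h0
      rw [← cast_weight_iff (F := F) (w1_lt k)] at hw1
      rw [← cast_weight_iff (F := F) (w2_lt k)] at hw2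
      rw [hh k hk' l hl (by rw [← hα, hw1]; ring) (by rw [← hβ, hw2]; ring)]
      ring
  simp only [coboundary_apply, map_sub]
  rw [key i hi j hj hα hβ, key j hj i hi (by rw [← hα]; ring) (by rw [← hβ]; ring), key']
  ring

theorem exists_balanced {c : M →ₗ[F] M →ₗ[F] M} (hc : IsCocycle c) :
    ∃ h : M →ₗ[F] M, Balanced e co (c - coboundary h) ∧
      ∀ n, coords e co (coboundary h) n = 0 := by
  classical
  obtain ⟨h, hh⟩ := B.exists_linearMap fun i k =>
    if (w1 k : F) - w1 i ≠ 0 then ((w1 k : F) - w1 i)⁻¹ * co k (c (e 30) (e i))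
    else if (w2 k : F) - w2 i ≠ 0 then ((w2 k : F) - w2 i)⁻¹ * co k (c (e 51) (e i))
    else 0
  refine ⟨h, fun i hi j hj l hl h0 => ?_, fun n => ?_⟩
  · by_contra hw
    refine h0 ?_
    simp only [LinearMap.sub_apply, map_sub]
    rw [sub_eq_zero]
    by_cases hα : (w1 l : F) - w1 i - w1 j = 0
    · by_cases hβ : (w2 l : F) - w2 i - w2 j = 0
      · refine absurd ⟨?_, ?_⟩ hw
        · rw [← cast_weight_iff (F := F) (w1_lt l)]
          linear_combination hα
        · rw [← cast_weight_iff (F := F) (w2_lt l)]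
          linear_combination hβ
      · rw [B.co_coboundary_congr (h' := c (e 51)) (s := ((w2 l : F) - w2 i - w2 j)⁻¹)
          (fun a ha b hb h1 h2 => ?_) hi hj hl rfl rfl,
          ← B.weight_mul_co hc (fun i hi => (B.lie_torus hi).2) hi hj hl,
          inv_mul_cancel_left₀ hβ]
        rw [hh a ha b hb, h1, if_neg (not_not.mpr hα), h2, if_pos hβ]
    · rw [B.co_coboundary_congr (h' := c (e 30)) (s := ((w1 l : F) - w1 i - w1 j)⁻¹)
        (fun a ha b hb h1 h2 => ?_) hi hj hl rfl rfl,
        ← B.weight_mul_co hc (fun i hi => (B.lie_torus hi).1) hi hj hl,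
        inv_mul_cancel_left₀ hα]
      rw [hh a ha b hb, h1, if_pos hα]
  · rw [coords, B.co_coboundary_congr (h' := 0) (s := 0) (α := 0) (β := 0)
      (fun a ha b hb h1 h2 => ?_) (Nat.mod_lt _ (by norm_num)) (Nat.mod_lt _ (by norm_num))
      (ix_lt _ _ (Nat.mod_lt _ (by norm_num))), zero_mul]
    · rw [sub_sub, sub_eq_zero, cast_weight_iff (w1_lt _), w1_ix]
    · rw [sub_sub, sub_eq_zero, cast_weight_iff (w2_lt _), w2_ix]
    · rw [hh a ha b hb, h1, h2]
      simp

/-- A cocycle that vanishes at the invariant coordinates is a coboundary. -/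
theorem exists_eq_coboundary {c : M →ₗ[F] M →ₗ[F] M} (hc : IsCocycle c)
    (h0 : ∀ n ∈ invariantKeys, coords e co c n = 0) : ∃ h : M →ₗ[F] M, c = coboundary h := by
  obtain ⟨h, hh⟩ := B.exists_gauge c
  have hc' := hc.sub (isCocycle_coboundary h)
  obtain ⟨h', hb, hh'⟩ := B.exists_balanced hc'
  refine ⟨h + h', ?_⟩
  have := B.eq_zero_of_coords (hc'.sub (isCocycle_coboundary h')) hb
    (fun n hn => by rw [coords_sub, coords_sub, hh n hn, hh' n, sub_self, sub_zero])
    (fun n hn => by rw [coords_sub, coords_sub, h0 n hn, hh' n,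
      B.coords_coboundary_invariantKeys h hn, sub_self, sub_zero])
  rw [sub_sub, sub_eq_zero, ← coboundary_add] at this
  exact this

end IsMelikianBasis

end Reduction

section Squaring

/-- The formal bracket of `e g` with a formal linear combination. -/
def adL (g : ℕ) : List (ℕ × ℕ) → List (ℕ × ℕ)
  | [] => []
  | p :: L => (br g p.1).map (fun q => (q.1, p.2 * q.2)) ++ adL g L

/-- The formal bracket of two formal linear combinations, times `s`. -/
def lieL (s : ℕ) : List (ℕ × ℕ) → List (ℕ × ℕ) → List (ℕ × ℕ)
  | [], _ => []
  | p :: L, L' => (adL p.1 L').map (fun q => (q.1, s * p.2 * q.2)) ++ lieL s L L'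

/-- The value at `(e x, e y)` of the square of `e g`. -/
def sqTerms (g x y : ℕ) : List (ℕ × ℕ) :=
  let a (n : ℕ) := (adL g)^[n] [(x, 1)]
  let b (n : ℕ) := (adL g)^[n] [(y, 1)]
  lieL 4 (a 1) (b 4) ++ (lieL 3 (a 2) (b 3) ++ (lieL 3 (a 3) (b 2) ++ lieL 4 (a 4) (b 1)))

/-- The coefficient of `k` in a formal linear combination. -/
def coefL (k : ℕ) (L : List (ℕ × ℕ)) : ℕ := (L.map fun p => if p.1 = k then p.2 else 0).sum

/-- The elements `1`, `D₁`, `D₂`, `D̃₁`, `D̃₂` whose squares represent the cohomology. -/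
def squareIndex : Fin 5 → ℕ := ![0, 25, 50, 75, 100]

def invariantKey (j : Fin 5) : ℕ := invariantKeys.getD j 0

/-- The value of the `i`-th square at the `j`-th invariant coordinate. -/
def sqMatrix (i j : Fin 5) : ℕ :=
  let n := invariantKey j
  coefL (ix (w1 (n / 625 % 125) + w1 (n / 5 % 125)) (w2 (n / 625 % 125) + w2 (n / 5 % 125)) (n % 5))
    (sqTerms (squareIndex i) (n / 625 % 125) (n / 5 % 125))

theorem sqMatrix_eq_zero_iff : ∀ i j : Fin 5, sqMatrix i j % 5 = 0 ↔ i ≠ j := by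
  decide +kernel

theorem mem_invariantKeys : ∀ n ∈ invariantKeys, ∃ j, invariantKey j = n := by
  decide +kernel

theorem invariantKey_mem : ∀ j, invariantKey j ∈ invariantKeys := by
  decide +kernel

variable {F : Type*} [Field F] {M : Type*} [LieRing M] [LieAlgebra F M]

theorem evalT_scale {V : Type*} [AddCommGroup V] [Module F V] (v : ℕ → V) (s : ℕ)
    (L : List (ℕ × ℕ)) :
    evalT F v (L.map fun q => (q.1, s * q.2)) = (s : F) • evalT F v L := by
  induction L with
  | nil => simp
  | cons p L ih => simp [ih, mul_smul]

theorem evalT_coefL (k : ℕ) (L : List (ℕ × ℕ)) :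
    evalT F (fun i => if i = k then (1 : F) else 0) L = (coefL k L : F) := by
  induction L with
  | nil => simp [coefL]
  | cons p L ih =>
    rw [evalT_cons, ih]
    simp only [coefL, List.map_cons, List.sum_cons, Nat.cast_add]
    split_ifs <;> simp

/-- The square `Sq x` as a bilinear map. -/
def square (x : M) : M →ₗ[F] M →ₗ[F] M :=
  ∑ i ∈ Finset.Icc 1 4, (((Nat.factorial i * Nat.factorial (5 - i) : ℕ) : F))⁻¹ •
    (LieModule.toEnd F M M : M →ₗ[F] Module.End F M).compl₁₂
      (LieModule.toEnd F M M x ^ i) (LieModule.toEnd F M M x ^ (5 - i))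

theorem sqCochain_eq_square (x a b : M) :
    sqCochain F 5 (fun z => ⁅x, z⁆) a b = square (F := F) x a b := by
  simp only [sqCochain, square, LinearMap.sum_apply, LinearMap.smul_apply,
    LinearMap.compl₁₂_apply, Module.End.pow_apply]
  rfl

variable [CharP F 5]

theorem square_apply (x a b : M) : square (F := F) x a b =
    (4 : F) • ⁅⁅x, a⁆, ⁅x, ⁅x, ⁅x, ⁅x, b⁆⁆⁆⁆⁆ + ((3 : F) • ⁅⁅x, ⁅x, a⁆⁆, ⁅x, ⁅x, ⁅x, b⁆⁆⁆⁆ +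
      ((3 : F) • ⁅⁅x, ⁅x, ⁅x, a⁆⁆⁆, ⁅x, ⁅x, b⁆⁆⁆ + (4 : F) • ⁅⁅x, ⁅x, ⁅x, ⁅x, a⁆⁆⁆⁆, ⁅x, b⁆⁆)) := by
  have h5 : (5 : F) = 0 := by exact_mod_cast CharP.cast_eq_zero F 5
  have h24 : (24 : F)⁻¹ = 4 := inv_eq_of_mul_eq_one_right (by linear_combination 19 * h5)
  have h12 : (12 : F)⁻¹ = 3 := inv_eq_of_mul_eq_one_right (by linear_combination 7 * h5)
  rw [← sqCochain_eq_square, sqCochain, show Finset.Icc 1 (5 - 1) = {1, 2, 3, 4} from rfl]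
  simp only [Finset.mem_insert, Finset.mem_singleton, Finset.sum_insert,
    Finset.sum_singleton, Nat.reduceSub, Nat.reduceEqDiff, or_self, not_false_eq_true,
    Function.iterate_succ, Function.iterate_zero, Function.comp_apply, id, Nat.factorial,
    Nat.reduceMul, Nat.reduceAdd, OfNat.one_ne_ofNat, Nat.succ_eq_add_one, zero_add, mul_one, one_mul]
  simp only [Nat.cast_ofNat, h24, h12]

/-- The fifth divided power of a derivation `d` yields a cocycle. -/
theorem jacobi_square_aux (d : M →ₗ[F] M) (hd : ∀ u v, d ⁅u, v⁆ = ⁅d u, v⁆ + ⁅u, d v⁆)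
    (s : M → M → M)
    (hs : ∀ a b, s a b = (4 : F) • ⁅d a, d (d (d (d b)))⁆ + ((3 : F) • ⁅d (d a), d (d (d b))⁆ +
      ((3 : F) • ⁅d (d (d a)), d (d b)⁆ + (4 : F) • ⁅d (d (d (d a))), d b⁆))) (a b c : M) :
    ⁅a, s b c⁆ + ⁅b, s c a⁆ + ⁅c, s a b⁆ + s a ⁅b, c⁆ + s b ⁅c, a⁆ + s c ⁅a, b⁆ = 0 := by
  have h5 : (5 : F) = 0 := by exact_mod_cast CharP.cast_eq_zero F 5
  have h44 : (4 : F) * 4 = 1 := by linear_combination 3 * h5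
  have h32 : (3 : F) * 2 = 1 := by linear_combination h5
  have h33 : (3 : F) * 3 = 4 := by linear_combination h5
  have h2 : ∀ u v, d (d ⁅u, v⁆) = ⁅d (d u), v⁆ + (2 : F) • ⁅d u, d v⁆ + ⁅u, d (d v)⁆ := by
    intro u v
    simp only [hd, map_add]
    module
  have h3 : ∀ u v, d (d (d ⁅u, v⁆)) = ⁅d (d (d u)), v⁆ + (3 : F) • ⁅d (d u), d v⁆ +
      (3 : F) • ⁅d u, d (d v)⁆ + ⁅u, d (d (d v))⁆ := by
    intro u v
    simp only [hd, map_add]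
    module
  have h4 : ∀ u v, d (d (d (d ⁅u, v⁆))) = ⁅d (d (d (d u))), v⁆ + (4 : F) • ⁅d (d (d u)), d v⁆ +
      ⁅d (d u), d (d v)⁆ + (4 : F) • ⁅d u, d (d (d v))⁆ + ⁅u, d (d (d (d v)))⁆ := by
    intro u v
    have h6 : ⁅d (d u), d (d v)⁆ = (6 : F) • ⁅d (d u), d (d v)⁆ := by
      rw [show (6 : F) = 1 by linear_combination h5, one_smul]
    rw [h6]
    simp only [hd, map_add]
    module
  rw [hs b c, hs c a, hs a b, hs a ⁅b, c⁆, hs b ⁅c, a⁆, hs c ⁅a, b⁆, h4 b c, h4 c a, h4 a b,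
    h3 b c, h3 c a, h3 a b, h2 b c, h2 c a, h2 a b, hd b c, hd c a, hd a b]
  simp only [lie_add, lie_smul, smul_add, smul_smul, h44, h32, h33]
  linear_combination (norm := module)
    (4 : F) • lie_jacobi a (d b) (d (d (d (d c)))) +
      (3 : F) • lie_jacobi a (d (d b)) (d (d (d c))) +
      (3 : F) • lie_jacobi a (d (d (d b))) (d (d c)) +
      (4 : F) • lie_jacobi a (d (d (d (d b)))) (d c) +
      (4 : F) • lie_jacobi (d a) b (d (d (d (d c)))) +
      (1 : F) • lie_jacobi (d a) (d b) (d (d (d c))) +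
      (4 : F) • lie_jacobi (d a) (d (d b)) (d (d c)) +
      (1 : F) • lie_jacobi (d a) (d (d (d b))) (d c) +
      (4 : F) • lie_jacobi (d a) (d (d (d (d b)))) c +
      (3 : F) • lie_jacobi (d (d a)) b (d (d (d c))) +
      (4 : F) • lie_jacobi (d (d a)) (d b) (d (d c)) +
      (4 : F) • lie_jacobi (d (d a)) (d (d b)) (d c) +
      (3 : F) • lie_jacobi (d (d a)) (d (d (d b))) c +
      (3 : F) • lie_jacobi (d (d (d a))) b (d (d c)) +
      (1 : F) • lie_jacobi (d (d (d a))) (d b) (d c) +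
      (3 : F) • lie_jacobi (d (d (d a))) (d (d b)) c +
      (4 : F) • lie_jacobi (d (d (d (d a)))) b (d c) +
      (4 : F) • lie_jacobi (d (d (d (d a)))) (d b) c

theorem isCocycle_square (x : M) : IsCocycle (square (F := F) x) where
  self a := by
    rw [square_apply, ← lie_skew ⁅x, a⁆, ← lie_skew ⁅x, ⁅x, a⁆⁆]
    module
  jacobi := jacobi_square_aux (LieModule.toEnd F M M x) (fun u v => leibniz_lie x u v) _
    (square_apply x)

namespace IsMelikianBasis

variable {e : ℕ → M} {co : ℕ → M →ₗ[F] F} (B : IsMelikianBasis e co)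
include B

omit [CharP F 5] in
theorem evalT_adL (g : ℕ) (L : List (ℕ × ℕ)) : evalT F e (adL g L) = ⁅e g, evalT F e L⁆ := by
  induction L with
  | nil => simp [adL]
  | cons p L ih => rw [adL, evalT_append, ih, evalT_scale, evalT_cons, lie_add, lie_smul, B.lie]

omit [CharP F 5] in
theorem evalT_lieL (s : ℕ) (L L' : List (ℕ × ℕ)) :
    evalT F e (lieL s L L') = (s : F) • ⁅evalT F e L, evalT F e L'⁆ := by
  induction L with
  | nil => simp [lieL]
  | cons p L ih =>
    rw [lieL, evalT_append, ih, evalT_scale, evalT_cons, add_lie, smul_lie, B.evalT_adL]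
    push_cast
    module

theorem evalT_sqTerms (g x y : ℕ) :
    evalT F e (sqTerms g x y) = square (F := F) (e g) (e x) (e y) := by
  rw [square_apply]
  simp only [sqTerms, evalT_append, B.evalT_lieL, Function.iterate_succ, Function.iterate_zero,
    Function.comp_apply, id, B.evalT_adL]
  simp

theorem coords_square (i j : Fin 5) :
    coords e co (square (e (squareIndex i))) (invariantKey j) = (sqMatrix i j : F) := by
  rw [coords, ← B.evalT_sqTerms, B.co_evalT (ix_lt _ _ (Nat.mod_lt _ (by norm_num))), evalT_coefL]
  rfl

theorem coords_square_ne {i j : Fin 5} (h : i ≠ j) :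
    coords e co (square (e (squareIndex i))) (invariantKey j) = 0 := by
  rw [B.coords_square, CharP.cast_eq_zero_iff F 5, Nat.dvd_iff_mod_eq_zero, sqMatrix_eq_zero_iff]
  exact h

theorem coords_square_self (i : Fin 5) :
    coords e co (square (e (squareIndex i))) (invariantKey i) ≠ 0 := by
  rw [B.coords_square, Ne, CharP.cast_eq_zero_iff F 5, Nat.dvd_iff_mod_eq_zero,
    sqMatrix_eq_zero_iff]
  exact fun h => h rfl

theorem coords_sum_square (a : Fin 5 → F) (j : Fin 5) :
    coords e co (∑ i, a i • square (e (squareIndex i))) (invariantKey j) =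
      a j * coords e co (square (e (squareIndex j))) (invariantKey j) := by
  have : coords e co (∑ i, a i • square (e (squareIndex i))) (invariantKey j) =
      ∑ i, a i * coords e co (square (e (squareIndex i))) (invariantKey j) := by
    simp [coords]
  rw [this]
  exact Finset.sum_eq_single j (fun i _ h => by rw [B.coords_square_ne h, mul_zero]) (by simp)

theorem squares_span {c : M →ₗ[F] M →ₗ[F] M} (hc : IsCocycle c) :
    ∃ (a : Fin 5 → F) (h : M →ₗ[F] M),
      c - ∑ i, a i • square (e (squareIndex i)) = coboundary h := by
  refine ⟨fun j => coords e co c (invariantKey j) /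
    coords e co (square (e (squareIndex j))) (invariantKey j), ?_⟩
  refine B.exists_eq_coboundary ?_ fun n hn => ?_
  · refine hc.sub ?_
    refine Finset.sum_induction _ IsCocycle (fun c d hc hd => ?_) ?_ fun i _ =>
      (isCocycle_square _).smul _
    · rw [← neg_neg d, ← sub_eq_add_neg]
      refine hc.sub ?_
      rw [← neg_one_smul F]
      exact hd.smul _
    · exact ⟨by simp, by simp⟩
  · obtain ⟨j, rfl⟩ := mem_invariantKeys n hn
    rw [coords_sub, B.coords_sum_square, div_mul_cancel₀ _ (B.coords_square_self j), sub_self]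

theorem squares_independent {a : Fin 5 → F} {h : M →ₗ[F] M}
    (ha : ∑ i, a i • square (e (squareIndex i)) = coboundary h) : a = 0 := by
  funext j
  have h1 := B.coords_sum_square a j
  rw [ha, B.coords_coboundary_invariantKeys h (invariantKey_mem j)] at h1
  exact (mul_eq_zero.mp h1.symm).resolve_right (B.coords_square_self j)

end IsMelikianBasis

end Squaring

section Realization

variable {F : Type*} [Field F]

/-- The exponent vector of `x₁ ^ a * x₂ ^ b`. -/
def expo (a b : ℕ) : Fin 2 →₀ ℕ := Finsupp.single 0 a + Finsupp.single 1 b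

theorem expo_zero (a b : ℕ) : expo a b 0 = a := by simp [expo]

theorem expo_one (a b : ℕ) : expo a b 1 = b := by simp [expo]

theorem expo_eta (u : Fin 2 →₀ ℕ) : expo (u 0) (u 1) = u := by
  ext i
  fin_cases i
  · exact expo_zero _ _
  · exact expo_one _ _

theorem expo_inj {a b c d : ℕ} : expo a b = expo c d ↔ a = c ∧ b = d := by
  refine ⟨fun h => ⟨?_, ?_⟩, by rintro ⟨rfl, rfl⟩; rfl⟩
  · simpa only [expo_zero] using DFunLike.congr_fun h 0
  · simpa only [expo_one] using DFunLike.congr_fun h 1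

variable (F) in
/-- The monomial `x₁ ^ a * x₂ ^ b` of `A(2)`. -/
def mon (a b : ℕ) : TruncPoly F 5 2 := xcl F 5 2 0 ^ a * xcl F 5 2 1 ^ b

theorem xcl_pow (i : Fin 2) {a : ℕ} (h : 5 ≤ a) : xcl F 5 2 i ^ a = 0 := by
  refine pow_eq_zero_of_le h ?_
  rw [xcl, ← map_pow]
  exact Ideal.Quotient.eq_zero_iff_mem.mpr (Ideal.subset_span ⟨i, rfl⟩)

theorem mon_eq_zero {a b : ℕ} (h : 5 ≤ a ∨ 5 ≤ b) : mon F a b = 0 := by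
  rcases h with h | h <;> simp [mon, xcl_pow _ h]

theorem mon_mul (a b c d : ℕ) : mon F a b * mon F c d = mon F (a + c) (b + d) := by
  simp only [mon]
  ring

theorem mk_monomial (a b : ℕ) (r : F) :
    Ideal.Quotient.mk (truncIdeal F 5 2) (MvPolynomial.monomial (expo a b) r) = r • mon F a b := by
  have : MvPolynomial.monomial (expo a b) r =
      r • (MvPolynomial.X 0 ^ a * MvPolynomial.X 1 ^ b : MvPolynomial (Fin 2) F) := by
    rw [MvPolynomial.X_pow_eq_monomial, MvPolynomial.X_pow_eq_monomial,
      MvPolynomial.monomial_mul, MvPolynomial.smul_monomial]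
    simp [expo]
  rw [this]
  rfl

theorem coeff_eq_zero_of_mem {f : MvPolynomial (Fin 2) F} (hf : f ∈ truncIdeal F 5 2) {a b : ℕ}
    (ha : a < 5) (hb : b < 5) : f.coeff (expo a b) = 0 := by
  have h : (Set.range fun i : Fin 2 => (MvPolynomial.X i ^ 5 : MvPolynomial (Fin 2) F)) =
      (fun s => MvPolynomial.monomial s (1 : F)) '' Set.range fun i : Fin 2 =>
        Finsupp.single i 5 := by
    rw [← Set.range_comp]
    simp [Function.comp_def, MvPolynomial.X_pow_eq_monomial]
  rw [truncIdeal, h, MvPolynomial.mem_ideal_span_monomial_image] at hf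
  by_contra h0
  obtain ⟨_, ⟨i, rfl⟩, hi⟩ := hf _ (MvPolynomial.mem_support_iff.mpr h0)
  have := hi i
  fin_cases i
  · simp [expo_zero] at this
    omega
  · simp [expo_one] at this
    omega

variable (F) in
/-- The coefficient of `x₁ ^ (k / 5) * x₂ ^ (k % 5)`, for `k < 25`. -/
def monCoeff (k : ℕ) : TruncPoly F 5 2 →ₗ[F] F :=
  ((truncIdeal F 5 2).restrictScalars F).liftQ
    (MvPolynomial.lcoeff F (expo (k / 5 % 5) (k % 5))) fun _ hf =>
      coeff_eq_zero_of_mem hf (Nat.mod_lt _ (by norm_num)) (Nat.mod_lt _ (by norm_num))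

theorem monCoeff_mk (k : ℕ) (f : MvPolynomial (Fin 2) F) :
    monCoeff F k (Ideal.Quotient.mk _ f) = f.coeff (expo (k / 5 % 5) (k % 5)) :=
  rfl

theorem monCoeff_mon (k a b : ℕ) :
    monCoeff F k (mon F a b) = if a = k / 5 % 5 ∧ b = k % 5 then 1 else 0 := by
  rw [← one_smul F (mon F a b), ← mk_monomial, monCoeff_mk, MvPolynomial.coeff_monomial]
  simp only [expo_inj]

theorem sum_monCoeff (f : TruncPoly F 5 2) :
    f = ∑ k ∈ Finset.range 25, monCoeff F k f • mon F (k / 5 % 5) (k % 5) := by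
  obtain ⟨f, rfl⟩ := Ideal.Quotient.mk_surjective f
  induction f using MvPolynomial.induction_on' with
  | monomial u r =>
    rw [← expo_eta u, mk_monomial]
    by_cases h : u 0 < 5 ∧ u 1 < 5
    · rw [Finset.sum_eq_single (5 * u 0 + u 1)]
      · have h0 : (5 * u 0 + u 1) / 5 % 5 = u 0 := by omega
        have h1 : (5 * u 0 + u 1) % 5 = u 1 := by omega
        rw [map_smul, monCoeff_mon, h0, h1, if_pos ⟨rfl, rfl⟩, smul_eq_mul, mul_one]
      · intro k hk hk'
        rw [Finset.mem_range] at hk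
        rw [map_smul, monCoeff_mon, if_neg (by omega), smul_zero, zero_smul]
      · intro hk
        rw [Finset.mem_range] at hk
        omega
    · rw [mon_eq_zero (by omega)]
      simp
  | add f g hf hg =>
    rw [map_add]
    simp only [map_add, add_smul, Finset.sum_add_distrib]
    rw [← hf, ← hg]

theorem derivation_ext {D E : WittJacobson F 5 2} (h : ∀ i, D (xcl F 5 2 i) = E (xcl F 5 2 i)) :
    D = E := by
  ext f
  obtain ⟨f, rfl⟩ := Ideal.Quotient.mk_surjective f
  induction f using MvPolynomial.induction_on with
  | C r =>
    exact (D.map_algebraMap r).trans (E.map_algebraMap r).symm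
  | add f g hf hg => rw [map_add, map_add, map_add, hf, hg]
  | mul_X f i hf =>
    rw [map_mul, Derivation.leibniz, Derivation.leibniz, hf]
    exact congrArg (fun y => _ • y + _) (h i)

/-- The bracket rules of the Melikian algebra. -/
structure IsMelikian (Dj : Fin 2 → WittJacobson F 5 2) {M : Type*} [LieRing M] [LieAlgebra F M]
    (φ : (TruncPoly F 5 2 × WittJacobson F 5 2 × WittJacobson F 5 2) ≃ₗ[F] M) : Prop where
  apply_xcl : ∀ j i, Dj j (xcl F 5 2 i) = if i = j then 1 else 0
  lie_WW : ∀ D E : WittJacobson F 5 2, ⁅φ (0, D, 0), φ (0, E, 0)⁆ = φ (0, ⁅D, E⁆, 0)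
  lie_WT : ∀ D E : WittJacobson F 5 2, ⁅φ (0, D, 0), φ (0, 0, E)⁆ =
    φ (0, 0, ⁅D, E⁆ + ((2 : TruncPoly F 5 2) * divW F Dj D) • E)
  lie_WA : ∀ (D : WittJacobson F 5 2) (f : TruncPoly F 5 2), ⁅φ (0, D, 0), φ (f, 0, 0)⁆ =
    φ (D f - (2 : TruncPoly F 5 2) * divW F Dj D * f, 0, 0)
  lie_TT : ∀ f₁ f₂ g₁ g₂ : TruncPoly F 5 2,
    ⁅φ (0, 0, f₁ • Dj 0 + f₂ • Dj 1), φ (0, 0, g₁ • Dj 0 + g₂ • Dj 1)⁆ =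
      φ (f₁ * g₂ - f₂ * g₁, 0, 0)
  lie_AT : ∀ (f : TruncPoly F 5 2) (E : WittJacobson F 5 2),
    ⁅φ (f, 0, 0), φ (0, 0, E)⁆ = φ (0, f • E, 0)
  lie_AA : ∀ f g : TruncPoly F 5 2, ⁅φ (f, 0, 0), φ (g, 0, 0)⁆ =
    φ (0, 0, ((2 : TruncPoly F 5 2) * (g * Dj 1 f - f * Dj 1 g)) • Dj 0 +
      ((2 : TruncPoly F 5 2) * (f * Dj 0 g - g * Dj 0 f)) • Dj 1)

/-- The element of type `t` with coefficient `f`: `f`, `f D₁`, `f D₂`, `f D̃₁`, `f D̃₂`. -/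
def vec (Dj : Fin 2 → WittJacobson F 5 2) :
    ℕ → TruncPoly F 5 2 → TruncPoly F 5 2 × WittJacobson F 5 2 × WittJacobson F 5 2
  | 0, f => (f, 0, 0)
  | 1, f => (0, f • Dj 0, 0)
  | 2, f => (0, f • Dj 1, 0)
  | 3, f => (0, 0, f • Dj 0)
  | 4, f => (0, 0, f • Dj 1)
  | _, _ => 0

/-- The coefficient function of type `t`. -/
def part : ℕ → (TruncPoly F 5 2 × WittJacobson F 5 2 × WittJacobson F 5 2) →ₗ[F] TruncPoly F 5 2
  | 0 => LinearMap.fst F _ _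
  | 1 =>
    { toFun y := y.2.1 (xcl F 5 2 0)
      map_add' _ _ := rfl
      map_smul' _ _ := rfl }
  | 2 =>
    { toFun y := y.2.1 (xcl F 5 2 1)
      map_add' _ _ := rfl
      map_smul' _ _ := rfl }
  | 3 =>
    { toFun y := y.2.2 (xcl F 5 2 0)
      map_add' _ _ := rfl
      map_smul' _ _ := rfl }
  | _ =>
    { toFun y := y.2.2 (xcl F 5 2 1)
      map_add' _ _ := rfl
      map_smul' _ _ := rfl }

theorem vec_add (Dj : Fin 2 → WittJacobson F 5 2) (t : ℕ) (f g : TruncPoly F 5 2) :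
    vec Dj t (f + g) = vec Dj t f + vec Dj t g := by
  match t with
  | 0 | 1 | 2 | 3 | 4 => simp [vec, add_smul]
  | _ + 5 => simp [vec]

theorem vec_smul (Dj : Fin 2 → WittJacobson F 5 2) (t : ℕ) (r : F) (f : TruncPoly F 5 2) :
    vec Dj t (r • f) = r • vec Dj t f := by
  match t with
  | 0 | 1 | 2 | 3 | 4 => simp [vec]
  | _ + 5 => simp [vec]

theorem vec_zero (Dj : Fin 2 → WittJacobson F 5 2) (t : ℕ) : vec Dj t 0 = 0 := by
  rw [← zero_smul F (0 : TruncPoly F 5 2), vec_smul, zero_smul]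

theorem vec_sum (Dj : Fin 2 → WittJacobson F 5 2) (t : ℕ) (s : Finset ℕ)
    (f : ℕ → TruncPoly F 5 2) : vec Dj t (∑ k ∈ s, f k) = ∑ k ∈ s, vec Dj t (f k) := by
  induction s using Finset.cons_induction with
  | empty => simp [vec_zero]
  | cons a s ha ih => rw [Finset.sum_cons, Finset.sum_cons, vec_add, ih]

variable {Dj : Fin 2 → WittJacobson F 5 2} {M : Type*} [LieRing M] [LieAlgebra F M]
  {φ : (TruncPoly F 5 2 × WittJacobson F 5 2 × WittJacobson F 5 2) ≃ₗ[F] M}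

/-- The basis vectors of the Melikian algebra. -/
def stdVec (Dj : Fin 2 → WittJacobson F 5 2)
    (φ : (TruncPoly F 5 2 × WittJacobson F 5 2 × WittJacobson F 5 2) ≃ₗ[F] M) (n : ℕ) : M :=
  φ (vec Dj (n / 25) (mon F (n / 5 % 5) (n % 5)))

/-- The coordinates of the Melikian algebra. -/
def stdCoord (φ : (TruncPoly F 5 2 × WittJacobson F 5 2 × WittJacobson F 5 2) ≃ₗ[F] M) (k : ℕ) :
    M →ₗ[F] F :=
  monCoeff F k ∘ₗ part (k / 25) ∘ₗ φ.symm.toLinearMap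

namespace IsMelikian

variable (H : IsMelikian Dj φ)
include H

theorem part_vec {s : ℕ} (hs : s < 5) (t : ℕ) (f : TruncPoly F 5 2) :
    part s (vec Dj t f) = if t = s then f else 0 := by
  interval_cases s <;> match t with
  | 0 | 1 | 2 | 3 | 4 => simp [vec, part, H.apply_xcl]
  | _ + 5 => simp [vec]

theorem derivation_eq (D : WittJacobson F 5 2) :
    D = D (xcl F 5 2 0) • Dj 0 + D (xcl F 5 2 1) • Dj 1 := by
  refine derivation_ext fun i => ?_
  fin_cases i <;> simp [H.apply_xcl]

theorem sum_vec_part (y : TruncPoly F 5 2 × WittJacobson F 5 2 × WittJacobson F 5 2) :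
    y = vec Dj 0 (part 0 y) + vec Dj 1 (part 1 y) + vec Dj 2 (part 2 y) + vec Dj 3 (part 3 y) +
      vec Dj 4 (part 4 y) := by
  obtain ⟨f, D, E⟩ := y
  simp only [vec, part, LinearMap.fst_apply, LinearMap.coe_mk, AddHom.coe_mk, Prod.mk_add_mk,
    add_zero, zero_add, Prod.mk.injEq, true_and]
  exact ⟨H.derivation_eq D, H.derivation_eq E⟩

theorem stdCoord_stdVec (i k : ℕ) (hk : k < 125) :
    stdCoord φ k (stdVec Dj φ i) = if i = k then 1 else 0 := by
  simp only [stdCoord, stdVec, LinearMap.comp_apply, LinearEquiv.coe_coe,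
    LinearEquiv.symm_apply_apply, H.part_vec (show k / 25 < 5 by omega)]
  by_cases h : i / 25 = k / 25
  · rw [if_pos h, monCoeff_mon]
    congr 1
    simp only [eq_iff_iff]
    omega
  · rw [if_neg h, map_zero, if_neg (by omega)]

theorem sum_stdCoord (m : M) :
    m = ∑ k ∈ Finset.range 125, stdCoord φ k m • stdVec Dj φ k := by
  obtain ⟨y, rfl⟩ := φ.surjective m
  have hsum : ∀ t < 5, φ (vec Dj t (part t y)) =
      ∑ k ∈ Finset.range 25, stdCoord φ (25 * t + k) (φ y) • stdVec Dj φ (25 * t + k) := by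
    intro t ht
    conv_lhs => rw [sum_monCoeff (part t y), vec_sum, map_sum]
    refine Finset.sum_congr rfl fun k hk => ?_
    rw [Finset.mem_range] at hk
    have h1 : (25 * t + k) / 25 = t := by omega
    have h2 : (25 * t + k) / 5 % 5 = k / 5 % 5 := by omega
    have h3 : (25 * t + k) % 5 = k % 5 := by omega
    have h4 : monCoeff F (25 * t + k) = monCoeff F k := by
      refine LinearMap.ext fun f => ?_
      obtain ⟨f, rfl⟩ := Ideal.Quotient.mk_surjective f
      rw [monCoeff_mk, monCoeff_mk, h2, h3]
    simp only [stdCoord, stdVec, LinearMap.comp_apply, LinearEquiv.coe_coe,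
      LinearEquiv.symm_apply_apply, h1, h2, h3, h4, vec_smul, map_smul]
  conv_lhs => rw [H.sum_vec_part y]
  rw [show 125 = 25 * 4 + 25 from rfl, Finset.sum_range_add, show 25 * 4 = 25 * 3 + 25 from rfl,
    Finset.sum_range_add, show 25 * 3 = 25 * 2 + 25 from rfl, Finset.sum_range_add,
    show 25 * 2 = 25 * 1 + 25 from rfl, Finset.sum_range_add]
  simp only [map_add, hsum 0 (by norm_num), hsum 1 (by norm_num), hsum 2 (by norm_num),
    hsum 3 (by norm_num), hsum 4 (by norm_num), mul_zero, zero_add]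

end IsMelikian

end Realization

section Brackets

variable {F : Type*} [Field F] {Dj : Fin 2 → WittJacobson F 5 2} {M : Type*} [LieRing M]
  [LieAlgebra F M]
  {φ : (TruncPoly F 5 2 × WittJacobson F 5 2 × WittJacobson F 5 2) ≃ₗ[F] M}

theorem derivation_smul_smul (f g : TruncPoly F 5 2) (D : WittJacobson F 5 2) :
    f • g • D = (f * g) • D :=
  Derivation.ext fun _ => (mul_assoc _ _ _).symm

theorem derivation_sub_smul (f g : TruncPoly F 5 2) (D : WittJacobson F 5 2) :
    (f - g) • D = f • D - g • D :=
  Derivation.ext fun _ => sub_mul _ _ _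

theorem derivation_zero_smul (D : WittJacobson F 5 2) : (0 : TruncPoly F 5 2) • D = 0 :=
  Derivation.ext fun _ => zero_mul _

theorem map_A_smul (r : F) (f : TruncPoly F 5 2) : φ (r • f, 0, 0) = r • φ (f, 0, 0) := by
  rw [← map_smul]
  simp

theorem map_A_sub (f g : TruncPoly F 5 2) : φ (f - g, 0, 0) = φ (f, 0, 0) - φ (g, 0, 0) := by
  rw [← map_sub]
  simp

theorem map_W_smul (r : F) (f : TruncPoly F 5 2) (D : WittJacobson F 5 2) :
    φ (0, (r • f) • D, 0) = r • φ (0, f • D, 0) := by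
  rw [← map_smul]
  simp

theorem map_T_add (f g : TruncPoly F 5 2) (D : WittJacobson F 5 2) :
    φ (0, 0, (f + g) • D) = φ (0, 0, f • D) + φ (0, 0, g • D) := by
  rw [← map_add]
  simp [add_smul]

theorem map_T_sub (f g : TruncPoly F 5 2) (D : WittJacobson F 5 2) :
    φ (0, 0, (f - g) • D) = φ (0, 0, f • D) - φ (0, 0, g • D) := by
  rw [← map_sub]
  simp [derivation_sub_smul]

theorem map_T_smul (r : F) (f : TruncPoly F 5 2) (D : WittJacobson F 5 2) :
    φ (0, 0, (r • f) • D) = r • φ (0, 0, f • D) := by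
  rw [← map_smul]
  simp

namespace IsMelikian

variable (H : IsMelikian Dj φ)
include H

theorem commutator (i j : Fin 2) (f g : TruncPoly F 5 2) :
    ⁅f • Dj i, g • Dj j⁆ = (f * Dj i g) • Dj j - (g * Dj j f) • Dj i := by
  refine derivation_ext fun k => ?_
  rw [Derivation.commutator_apply]
  simp only [Derivation.smul_apply, Derivation.sub_apply, H.apply_xcl, smul_eq_mul]
  split_ifs <;> simp

theorem divW_smul (i : Fin 2) (f : TruncPoly F 5 2) : divW F Dj (f • Dj i) = Dj i f := by
  simp only [divW, Derivation.smul_apply, H.apply_xcl, smul_eq_mul]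
  fin_cases i <;> simp

omit H in
theorem two_mul_eq (f : TruncPoly F 5 2) : 2 * f = (2 : F) • f := by
  rw [two_smul, two_mul]

theorem lie_vec_WW (i j : Fin 2) (f g : TruncPoly F 5 2) :
    ⁅φ (0, f • Dj i, 0), φ (0, g • Dj j, 0)⁆ =
      φ (0, (f * Dj i g) • Dj j, 0) - φ (0, (Dj j f * g) • Dj i, 0) := by
  rw [H.lie_WW, H.commutator, ← map_sub]
  simp [mul_comm]

theorem lie_vec_WT (i j : Fin 2) (f g : TruncPoly F 5 2) :
    ⁅φ (0, f • Dj i, 0), φ (0, 0, g • Dj j)⁆ =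
      φ (0, 0, (f * Dj i g + (2 : F) • (Dj i f * g)) • Dj j) -
        φ (0, 0, (Dj j f * g) • Dj i) := by
  rw [H.lie_WT, H.commutator, H.divW_smul, ← map_sub, derivation_smul_smul, mul_assoc, two_mul_eq]
  refine congrArg φ (Prod.ext (sub_zero _).symm (Prod.ext ?_ ?_))
  · refine Derivation.ext fun _ => ?_
    exact (sub_zero _).symm
  · rw [add_smul, mul_comm (Dj j f)]
    refine Derivation.ext fun _ => ?_
    exact sub_add_eq_add_sub _ _ _

theorem lie_vec_WA (i : Fin 2) (f g : TruncPoly F 5 2) :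
    ⁅φ (0, f • Dj i, 0), φ (g, 0, 0)⁆ = φ (f * Dj i g - (2 : F) • (Dj i f * g), 0, 0) := by
  rw [H.lie_WA, H.divW_smul, mul_assoc, two_mul_eq]
  rfl

theorem lie_vec_TT (f g : TruncPoly F 5 2) :
    ⁅φ (0, 0, f • Dj 0), φ (0, 0, g • Dj 1)⁆ = φ (f * g, 0, 0) := by
  simpa [derivation_zero_smul, ← Prod.zero_eq_mk] using H.lie_TT f 0 0 g

theorem lie_vec_TT_zero (f g : TruncPoly F 5 2) :
    ⁅φ (0, 0, f • Dj 0), φ (0, 0, g • Dj 0)⁆ = 0 := by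
  simpa [derivation_zero_smul, ← Prod.zero_eq_mk] using H.lie_TT f 0 g 0

theorem lie_vec_TT_one (f g : TruncPoly F 5 2) :
    ⁅φ (0, 0, f • Dj 1), φ (0, 0, g • Dj 1)⁆ = 0 := by
  simpa [derivation_zero_smul, ← Prod.zero_eq_mk] using H.lie_TT 0 f 0 g

theorem lie_vec_AT (i : Fin 2) (f g : TruncPoly F 5 2) :
    ⁅φ (f, 0, 0), φ (0, 0, g • Dj i)⁆ = φ (0, (f * g) • Dj i, 0) := by
  rw [H.lie_AT, derivation_smul_smul]

theorem lie_vec_AA (f g : TruncPoly F 5 2) :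
    ⁅φ (f, 0, 0), φ (g, 0, 0)⁆ = φ (0, 0, ((2 : F) • (Dj 1 f * g - f * Dj 1 g)) • Dj 0) +
      φ (0, 0, ((2 : F) • (f * Dj 0 g - Dj 0 f * g)) • Dj 1) := by
  rw [H.lie_AA, ← map_add, two_mul_eq, two_mul_eq, mul_comm g, mul_comm g]
  simp

theorem apply_zero_mon (a b : ℕ) : Dj 0 (mon F a b) = (a : F) • mon F (a - 1) b := by
  rw [Nat.cast_smul_eq_nsmul, nsmul_eq_mul]
  simp [mon, Derivation.leibniz, Derivation.leibniz_pow, H.apply_xcl]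
  ring

theorem apply_one_mon (a b : ℕ) : Dj 1 (mon F a b) = (b : F) • mon F a (b - 1) := by
  rw [Nat.cast_smul_eq_nsmul, nsmul_eq_mul]
  simp [mon, Derivation.leibniz, Derivation.leibniz_pow, H.apply_xcl]
  ring

theorem mon_mul_apply_zero (a b c d : ℕ) :
    mon F a b * Dj 0 (mon F c d) = (c : F) • mon F (a + c - 1) (b + d) := by
  rw [H.apply_zero_mon, mul_smul_comm, mon_mul]
  rcases c with _ | c
  · simp
  · rfl

theorem apply_zero_mul_mon (a b c d : ℕ) :
    Dj 0 (mon F a b) * mon F c d = (a : F) • mon F (a + c - 1) (b + d) := by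
  rw [mul_comm, H.mon_mul_apply_zero, add_comm c, add_comm d]

theorem mon_mul_apply_one (a b c d : ℕ) :
    mon F a b * Dj 1 (mon F c d) = (d : F) • mon F (a + c) (b + d - 1) := by
  rw [H.apply_one_mon, mul_smul_comm, mon_mul]
  rcases d with _ | d
  · simp
  · rfl

theorem apply_one_mul_mon (a b c d : ℕ) :
    Dj 1 (mon F a b) * mon F c d = (b : F) • mon F (a + c) (b + d - 1) := by
  rw [mul_comm, H.mon_mul_apply_one, add_comm c, add_comm d]

omit H
variable [CharP F 5]

theorem natCast_mod (c : ℕ) : ((c % 5 : ℕ) : F) = c :=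
  (CharP.cast_eq_mod F 5 c).symm

theorem evalT_term {t : ℕ} (a b c : ℕ) :
    evalT F (stdVec Dj φ) (term t a b c) = (c : F) • φ (vec Dj t (mon F a b)) := by
  rw [term, force_eq]
  by_cases h : 5 ≤ a ∨ 5 ≤ b
  · rw [mon_eq_zero h, vec_zero, map_zero, smul_zero]
    rcases h with h | h <;> simp [Nat.ble_eq_true_of_le h]
  · rw [← natCast_mod c]
    by_cases hc : c % 5 = 0
    · simp [hc]
    · have h1 : Nat.ble 5 a = false := by
        rw [← Bool.not_eq_true, Nat.ble_eq]
        omega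
      have h2 : Nat.ble 5 b = false := by
        rw [← Bool.not_eq_true, Nat.ble_eq]
        omega
      have h3 : Nat.beq (c % 5) 0 = false := by
        rw [← Bool.not_eq_true, Nat.beq_eq]
        exact hc
      have h4 : (25 * t + 5 * a + b) / 25 = t := by omega
      have h5 : (25 * t + 5 * a + b) / 5 % 5 = a := by omega
      have h6 : (25 * t + 5 * a + b) % 5 = b := by omega
      simp [h1, h2, h3, force_eq, stdVec, h4, h5, h6]

variable (F) in
theorem eight_eq : (8 : F) = -2 := by linear_combination 2 * four_eq_neg_one F

variable (F) in
theorem three_eq : (3 : F) = -2 := by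
  have h : ((5 : ℕ) : F) = 0 := CharP.cast_eq_zero F 5
  push_cast at h
  linear_combination h

include H in
theorem lie_vec_mon (a b c d t s : ℕ) :
    ⁅φ (vec Dj t (mon F a b)), φ (vec Dj s (mon F c d))⁆ =
      evalT F (stdVec Dj φ) (brk a b c d t s) := by
  have skew : ∀ {x y z : M}, ⁅y, x⁆ = z → ⁅x, y⁆ = -z := fun h => by rw [← h, lie_skew]
  refine match t, s with
  | 0, 0 => (H.lie_vec_AA _ _).trans ?_
  | 0, 1 => (skew (H.lie_vec_WA 0 _ _)).trans ?_
  | 0, 2 => (skew (H.lie_vec_WA 1 _ _)).trans ?_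
  | 0, 3 => (H.lie_vec_AT 0 _ _).trans ?_
  | 0, 4 => (H.lie_vec_AT 1 _ _).trans ?_
  | 1, 0 => (H.lie_vec_WA 0 _ _).trans ?_
  | 1, 1 => (H.lie_vec_WW 0 0 _ _).trans ?_
  | 1, 2 => (H.lie_vec_WW 0 1 _ _).trans ?_
  | 1, 3 => (H.lie_vec_WT 0 0 _ _).trans ?_
  | 1, 4 => (H.lie_vec_WT 0 1 _ _).trans ?_
  | 2, 0 => (H.lie_vec_WA 1 _ _).trans ?_
  | 2, 1 => (H.lie_vec_WW 1 0 _ _).trans ?_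
  | 2, 2 => (H.lie_vec_WW 1 1 _ _).trans ?_
  | 2, 3 => (H.lie_vec_WT 1 0 _ _).trans ?_
  | 2, 4 => (H.lie_vec_WT 1 1 _ _).trans ?_
  | 3, 0 => (skew (H.lie_vec_AT 0 _ _)).trans ?_
  | 3, 1 => (skew (H.lie_vec_WT 0 0 _ _)).trans ?_
  | 3, 2 => (skew (H.lie_vec_WT 1 0 _ _)).trans ?_
  | 3, 3 => H.lie_vec_TT_zero _ _
  | 3, 4 => (H.lie_vec_TT _ _).trans ?_
  | 4, 0 => (skew (H.lie_vec_AT 1 _ _)).trans ?_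
  | 4, 1 => (skew (H.lie_vec_WT 0 1 _ _)).trans ?_
  | 4, 2 => (skew (H.lie_vec_WT 1 1 _ _)).trans ?_
  | 4, 3 => (skew (H.lie_vec_TT _ _)).trans ?_
  | 4, 4 => H.lie_vec_TT_one _ _
  | _ + 5, _ => by simp [vec, brk]
  | 0, _ + 5 | 1, _ + 5 | 2, _ + 5 | 3, _ + 5 | 4, _ + 5 => by simp [vec, brk]
  all_goals
    simp only [brk, evalT_append, evalT_term, vec, mon_mul, H.mon_mul_apply_zero,
      H.mon_mul_apply_one, H.apply_zero_mul_mon, H.apply_one_mul_mon, map_A_sub, map_A_smul,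
      map_W_smul, map_T_add, map_T_sub, map_T_smul]
    push_cast [eight_eq, three_eq, four_eq_neg_one, add_comm c a, add_comm d b]
    module

end IsMelikian

end Brackets

section Cohomology

variable {F : Type*} [Field F] {M : Type*} [LieRing M] [LieAlgebra F M]

theorem IsLieCocycle2.exists_linearMap {c : M → M → M} (hc : IsLieCocycle2 F c) :
    ∃ c' : M →ₗ[F] M →ₗ[F] M, IsCocycle c' ∧ ∀ x y, c' x y = c x y := by
  obtain ⟨hl, hr, hs, hj⟩ := hc
  have hl0 : ∀ y, c 0 y = 0 := fun y => by simpa using hl 1 0 0 y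
  have hr0 : ∀ x, c x 0 = 0 := fun x => by simpa using hr 1 x 0 0
  refine ⟨LinearMap.mk₂ F c (fun x x' y => ?_) (fun a x y => ?_) (fun x y y' => ?_)
    (fun a x y => ?_), ⟨hs, hj⟩, fun _ _ => rfl⟩
  · simpa using hl 1 x x' y
  · simpa [hl0] using hl a x 0 y
  · simpa using hr 1 x y y'
  · simpa [hr0] using hr a x y 0

theorem IsCocycle.isLieCocycle2 {c : M →ₗ[F] M →ₗ[F] M} (hc : IsCocycle c) :
    IsLieCocycle2 F fun x y => c x y :=
  ⟨fun _ _ _ _ => by simp, fun _ _ _ _ => by simp, hc.self, hc.jacobi⟩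

theorem isLieCoboundary2_iff {c : M →ₗ[F] M →ₗ[F] M} :
    IsLieCoboundary2 F (fun x y => c x y) ↔ ∃ h, c = coboundary h :=
  exists_congr fun _ => ⟨fun h => LinearMap.ext₂ h, fun h _ _ => by subst h; rfl⟩

variable {Dj : Fin 2 → WittJacobson F 5 2}
  {φ : (TruncPoly F 5 2 × WittJacobson F 5 2 × WittJacobson F 5 2) ≃ₗ[F] M}

theorem sum_squares (c₀ : F) (aW aT : Fin 2 → F) :
    c₀ • sqCochain F 5 (fun z : M => ⁅φ (1, 0, 0), z⁆) +
      (∑ i : Fin 2, aW i • sqCochain F 5 (fun z : M => ⁅φ (0, Dj i, 0), z⁆)) +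
      (∑ i : Fin 2, aT i • sqCochain F 5 (fun z : M => ⁅φ (0, 0, Dj i), z⁆)) =
    fun x y => (∑ i, ![c₀, aW 0, aW 1, aT 0, aT 1] i •
      square (F := F) (stdVec Dj φ (squareIndex i))) x y := by
  funext x y
  simp only [Pi.add_apply, Pi.smul_apply, Fin.sum_univ_two, Fin.sum_univ_five,
    sqCochain_eq_square, LinearMap.add_apply, LinearMap.smul_apply]
  simp [squareIndex, stdVec, vec, mon, add_assoc]

variable [CharP F 5]

theorem isLieCocycle2_sqCochain (x : M) : IsLieCocycle2 F (sqCochain F 5 fun z : M => ⁅x, z⁆) := by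
  convert (isCocycle_square (F := F) x).isLieCocycle2 using 1
  funext a b
  exact sqCochain_eq_square x a b

theorem IsMelikian.isMelikianBasis (H : IsMelikian Dj φ) :
    IsMelikianBasis (stdVec Dj φ) (stdCoord φ) where
  co_e := H.stdCoord_stdVec
  expand := H.sum_stdCoord
  lie i j := by
    simp only [br, force_eq]
    exact H.lie_vec_mon _ _ _ _ _ _

end Cohomology

end Melikian

/-- `H²(M, M)` for the Melikian algebra `M` (`p = 5`). -/
theorem melikian_H2
    (F : Type*) [Field F] [IsAlgClosed F] [CharP F 5]
    (Dj : Fin 2 → WittJacobson F 5 2)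
    (hDj : ∀ j i, Dj j (xcl F 5 2 i) = if i = j then 1 else 0)
    (M : Type*) [LieRing M] [LieAlgebra F M]
    (φ : (TruncPoly F 5 2 × WittJacobson F 5 2 × WittJacobson F 5 2) ≃ₗ[F] M)
    -- the bracket rules of the Melikian algebra:
    -- `W(2)` is a subalgebra
    (hWW : ∀ D E : WittJacobson F 5 2,
      ⁅φ (0, D, 0), φ (0, E, 0)⁆ = φ (0, ⁅D, E⁆, 0))
    -- `[D, Ẽ] = ([D,E])~ + 2 div(D) Ẽ`
    (hWT : ∀ D E : WittJacobson F 5 2,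
      ⁅φ (0, D, 0), φ (0, 0, E)⁆ =
        φ (0, 0, ⁅D, E⁆ + ((2 : TruncPoly F 5 2) * divW F Dj D) • E))
    -- `[D, f] = D(f) − 2 div(D) f`
    (hWA : ∀ (D : WittJacobson F 5 2) (f : TruncPoly F 5 2),
      ⁅φ (0, D, 0), φ (f, 0, 0)⁆ =
        φ (D f - (2 : TruncPoly F 5 2) * divW F Dj D * f, 0, 0))
    -- `[f₁D̃₁ + f₂D̃₂, g₁D̃₁ + g₂D̃₂] = f₁g₂ − f₂g₁`
    (hTT : ∀ f₁ f₂ g₁ g₂ : TruncPoly F 5 2,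
      ⁅φ (0, 0, f₁ • Dj 0 + f₂ • Dj 1), φ (0, 0, g₁ • Dj 0 + g₂ • Dj 1)⁆ =
        φ (f₁ * g₂ - f₂ * g₁, 0, 0))
    -- `[f, Ẽ] = f·E`
    (hAT : ∀ (f : TruncPoly F 5 2) (E : WittJacobson F 5 2),
      ⁅φ (f, 0, 0), φ (0, 0, E)⁆ = φ (0, f • E, 0))
    -- `[f, g] = 2(g·D₂(f) − f·D₂(g))D̃₁ + 2(f·D₁(g) − g·D₁(f))D̃₂`
    (hAA : ∀ f g : TruncPoly F 5 2,
      ⁅φ (f, 0, 0), φ (g, 0, 0)⁆ =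
        φ (0, 0,
          ((2 : TruncPoly F 5 2) * (g * Dj 1 f - f * Dj 1 g)) • Dj 0 +
          ((2 : TruncPoly F 5 2) * (f * Dj 0 g - g * Dj 0 f)) • Dj 1)) :
    -- the five squaring classes are `2`-cocycles of `M`
    IsLieCocycle2 F (sqCochain F 5 (fun z : M => ⁅φ (1, 0, 0), z⁆)) ∧
    (∀ i : Fin 2, IsLieCocycle2 F (sqCochain F 5 (fun z : M => ⁅φ (0, Dj i, 0), z⁆))) ∧
    (∀ i : Fin 2, IsLieCocycle2 F (sqCochain F 5 (fun z : M => ⁅φ (0, 0, Dj i), z⁆))) ∧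
    -- they span `H²(M, M)` …
    (∀ c : M → M → M, IsLieCocycle2 F c →
      ∃ (c₀ : F) (aW aT : Fin 2 → F),
        IsLieCoboundary2 F
          (c - c₀ • sqCochain F 5 (fun z : M => ⁅φ (1, 0, 0), z⁆) -
            (∑ i : Fin 2, aW i • sqCochain F 5 (fun z : M => ⁅φ (0, Dj i, 0), z⁆)) -
            (∑ i : Fin 2, aT i • sqCochain F 5 (fun z : M => ⁅φ (0, 0, Dj i), z⁆)))) ∧
    -- … and are linearly independent in `H²(M, M)`
    (∀ (c₀ : F) (aW aT : Fin 2 → F),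
      IsLieCoboundary2 F
        ((c₀ • sqCochain F 5 (fun z : M => ⁅φ (1, 0, 0), z⁆) +
          (∑ i : Fin 2, aW i • sqCochain F 5 (fun z : M => ⁅φ (0, Dj i, 0), z⁆)) +
          (∑ i : Fin 2, aT i • sqCochain F 5 (fun z : M => ⁅φ (0, 0, Dj i), z⁆)) :
          M → M → M)) → c₀ = 0 ∧ aW = 0 ∧ aT = 0) := by
  have H : Melikian.IsMelikian Dj φ := ⟨hDj, hWW, hWT, hWA, hTT, hAT, hAA⟩
  have B := H.isMelikianBasis
  refine ⟨Melikian.isLieCocycle2_sqCochain _, fun _ => Melikian.isLieCocycle2_sqCochain _,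
    fun _ => Melikian.isLieCocycle2_sqCochain _, fun c hc => ?_, fun c₀ aW aT h => ?_⟩
  · obtain ⟨c', hc', hcc'⟩ := Melikian.IsLieCocycle2.exists_linearMap hc
    obtain ⟨a, h, hah⟩ := B.squares_span hc'
    refine ⟨a 0, ![a 1, a 2], ![a 3, a 4], ?_⟩
    rw [sub_sub, sub_sub, ← add_assoc, Melikian.sum_squares]
    convert Melikian.isLieCoboundary2_iff.mpr ⟨h, hah⟩ using 1
    funext x y
    simp only [Pi.sub_apply, LinearMap.sub_apply, hcc']
    congr 5
    funext i
    fin_cases i <;> rfl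
  · rw [Melikian.sum_squares] at h
    obtain ⟨h, hh⟩ := Melikian.isLieCoboundary2_iff.mp h
    have h0 := B.squares_independent hh
    have h1 : ∀ i, ![c₀, aW 0, aW 1, aT 0, aT 1] i = 0 := fun i => by rw [h0]; rfl
    refine ⟨h1 0, funext fun i => ?_, funext fun i => ?_⟩
    · fin_cases i
      · exact h1 1
      · exact h1 2
    · fin_cases i
      · exact h1 3
      · exact h1 4

end
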